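/- arXiv:1708.00558 — 5 statements merged into one kernel-verified Lean document; each statement's English description precedes it below -/
import Mathlib

section
/- Let $d\ge2$ and let $(\chi_\varepsilon)_{\varepsilon\in(0,1)}$ be $\mathbb{R}^d$-valued random vectors on a probability space converging in probability, as $\varepsilon\downarrow0$, to a random vector $\chi$ with $\mathrm P(\chi^{(d)}=0)=0$, and let $(\tau_\varepsilon)_{\varepsilon\in(0,1)}$ be positive random variables with $\tau_\varepsilon\to\infty$ in probability. For $1\le i\le d$ set $V_\varepsilon^{(i)}=\sum_{j=0}^{d-i}\frac{\tau_\varepsilon^{\,j}}{j!}\,\chi_\varepsilon^{(i+j)}$. Then $\mathrm P(V_\varepsilon^{(1)}=0)\to0$ as $\varepsilon\downarrow0$ and, for each $2\le i\le d$, the ratio $V_\varepsilon^{(i)}/V_\varepsilon^{(1)}$ (defined to be $0$ on the event $V_\varepsilon^{(1)}=0$) converges to $0$ in probability as $\varepsilon\downarrow0$. -/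
open Filter Topology MeasureTheory

/-- A polynomial in `t` with bounded coefficients whose top coefficient stays away from
zero dominates, for large `t`, its lower-degree tails. -/
lemma exists_forall_tail_ratio_le (n : ℕ) {c δ M : ℝ} (hc : 0 < c) (hδ : 0 < δ)
    (hM : 0 ≤ M) :
    ∃ T : ℝ, ∀ t : ℝ, T < t → ∀ x v : Fin (n + 2) → ℝ, ‖x‖ ≤ M →
      c ≤ |x (Fin.last (n + 1))| →
      (∀ i : Fin (n + 2), v i = ∑ j : Fin (n + 2), if (i : ℕ) ≤ (j : ℕ) then
        t ^ ((j : ℕ) - (i : ℕ)) / Nat.factorial ((j : ℕ) - (i : ℕ)) * x j else 0) →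
      v 0 ≠ 0 ∧ ∀ i : Fin (n + 2), 1 ≤ (i : ℕ) → |v i / v 0| ≤ δ := by
  set D : ℝ := ((n + 2 : ℕ) : ℝ) * M with hD
  have hD0 : 0 ≤ D := by positivity
  have hf : (0 : ℝ) < ((n + 1).factorial : ℝ) := by positivity
  refine ⟨max 1 ((D + D / δ + 1) * (n + 1).factorial / c), fun t ht x v hx hxc hv => ?_⟩
  obtain ⟨ht1, ht2⟩ := max_lt_iff.mp ht
  have hpow : 0 < t ^ n := by positivity
  have hterm : ∀ (k : ℕ) (j : Fin (n + 2)), k ≤ n → |t ^ k / k.factorial * x j| ≤ t ^ n * M := by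
    intro k j hk
    have hxj : |x j| ≤ M := (norm_le_pi_norm x j).trans hx
    have hfac : (1 : ℝ) ≤ k.factorial := by exact_mod_cast k.factorial_pos
    have hpk : t ^ k / k.factorial ≤ t ^ n :=
      (div_le_self (by positivity) hfac).trans (pow_le_pow_right₀ ht1.le hk)
    rw [abs_mul, abs_of_nonneg (by positivity : 0 ≤ t ^ k / (k.factorial : ℝ))]
    gcongr
  have htail : ∀ i : Fin (n + 2), 1 ≤ (i : ℕ) → |v i| ≤ t ^ n * D := by
    intro i hi
    rw [hv i]
    calc _ ≤ ∑ _j : Fin (n + 2), t ^ n * M := by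
          refine (Finset.abs_sum_le_sum_abs _ _).trans (Finset.sum_le_sum fun j _ => ?_)
          split_ifs
          · exact hterm _ j (by omega)
          · rw [abs_zero]; positivity
      _ = t ^ n * D := by
          rw [Finset.sum_const, Finset.card_univ, Fintype.card_fin, nsmul_eq_mul, hD]; ring
  have hlow : |∑ j : Fin (n + 1), t ^ (j : ℕ) / (j : ℕ).factorial * x j.castSucc| ≤ t ^ n * D := by
    calc _ ≤ ∑ _j : Fin (n + 1), t ^ n * M := by
          refine (Finset.abs_sum_le_sum_abs _ _).trans (Finset.sum_le_sum fun j _ => ?_)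
          exact hterm _ _ (by omega)
      _ ≤ t ^ n * D := by
          rw [Finset.sum_const, Finset.card_univ, Fintype.card_fin, nsmul_eq_mul, hD]
          push_cast
          nlinarith [mul_nonneg hpow.le hM]
  have hv0 : v 0 = (∑ j : Fin (n + 1), t ^ (j : ℕ) / (j : ℕ).factorial * x j.castSucc)
      + t ^ (n + 1) / (n + 1).factorial * x (Fin.last (n + 1)) := by
    rw [hv, Fin.sum_univ_castSucc]
    simp
  have htop : t ^ n * (D + D / δ + 1) ≤
      |t ^ (n + 1) / (n + 1).factorial * x (Fin.last (n + 1))| := by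
    rw [div_lt_iff₀ hc, ← lt_div_iff₀ hf] at ht2
    rw [abs_mul, abs_of_nonneg (by positivity : 0 ≤ t ^ (n + 1) / ((n + 1).factorial : ℝ))]
    calc t ^ n * (D + D / δ + 1) ≤ t ^ n * (t * c / (n + 1).factorial) := by gcongr
      _ = t ^ (n + 1) / (n + 1).factorial * c := by ring
      _ ≤ _ := by gcongr
  have hhead : t ^ n * (D / δ + 1) ≤ |v 0| := by
    have h := abs_sub_abs_le_abs_add (t ^ (n + 1) / (n + 1).factorial * x (Fin.last (n + 1)))
      (∑ j : Fin (n + 1), t ^ (j : ℕ) / (j : ℕ).factorial * x j.castSucc)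
    rw [add_comm (t ^ (n + 1) / _ * _), ← hv0] at h
    linarith
  have hpos : 0 < |v 0| := lt_of_lt_of_le (by positivity) hhead
  refine ⟨abs_pos.mp hpos, fun i hi => ?_⟩
  rw [abs_div, div_le_iff₀ hpos]
  calc |v i| ≤ t ^ n * D := htail i hi
    _ = δ * (t ^ n * (D / δ)) := by field_simp
    _ ≤ δ * (t ^ n * (D / δ + 1)) := by gcongr; linarith
    _ ≤ _ := by gcongr

/-- A random vector whose given coordinate is almost surely nonzero is, with probability close to
one, bounded with that coordinate bounded away from zero. -/
lemma tendsto_measure_not_bounded_nondegenerate {ι Ω : Type*} [Fintype ι] [MeasurableSpace Ω]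
    (P : Measure Ω) [IsFiniteMeasure P] {X : Ω → ι → ℝ} (hX : Measurable X) (k : ι)
    (hk : P {ω | X ω k = 0} = 0) :
    Tendsto (fun n : ℕ => P {ω | |X ω k| ≤ 1 / ((n : ℝ) + 1) ∨ (n : ℝ) ≤ ‖X ω‖}) atTop (𝓝 0) := by
  have hXk : Measurable fun ω => X ω k := (measurable_pi_apply k).comp hX
  have hanti : Antitone fun n : ℕ => {ω | |X ω k| ≤ 1 / ((n : ℝ) + 1) ∨ (n : ℝ) ≤ ‖X ω‖} := by
    intro m n hmn ω hω
    have hmn' : (m : ℝ) ≤ n := by exact_mod_cast hmn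
    exact hω.imp (fun h => h.trans (by gcongr)) hmn'.trans
  have hlim := tendsto_measure_iInter_atTop (μ := P)
    (s := fun n : ℕ => {ω | |X ω k| ≤ 1 / ((n : ℝ) + 1) ∨ (n : ℝ) ≤ ‖X ω‖})
    (fun n => ((measurableSet_le hXk.abs measurable_const).union
      (measurableSet_le measurable_const hX.norm)).nullMeasurableSet)
    hanti ⟨0, measure_ne_top _ _⟩
  rwa [measure_mono_null (fun ω hω => ?_) hk] at hlim
  by_contra h
  obtain ⟨a, ha⟩ := exists_nat_one_div_lt (abs_pos.mpr h)
  obtain ⟨b, hb⟩ := exists_nat_gt ‖X ω‖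
  have hmem := Set.mem_iInter.mp hω (max a b)
  have hbm : (b : ℝ) ≤ (max a b : ℕ) := by exact_mod_cast le_max_right a b
  have ham : 1 / (((max a b : ℕ) : ℝ) + 1) ≤ 1 / ((a : ℝ) + 1) := by
    have : (a : ℝ) ≤ (max a b : ℕ) := by exact_mod_cast le_max_left a b
    gcongr
  rcases hmem with h1 | h1 <;> linarith

/-- Events excluded by large `τ` together with a bounded, nondegenerate value of `χ` have vanishing
probability, when `χ` converges in probability to a vector with an almost surely nonzero
coordinate `k` and `τ` tends to infinity in probability. -/
lemma tendsto_measure_zero_of_exclusion {α ι Ω : Type*} [Fintype ι] [MeasurableSpace Ω]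
    (P : Measure Ω) [IsFiniteMeasure P] {l : Filter α} {χ : α → Ω → ι → ℝ} {χ₀ : Ω → ι → ℝ}
    (hχ₀ : Measurable χ₀)
    (hχ : ∀ δ > (0 : ℝ), Tendsto (fun a => P {ω | δ < dist (χ a ω) (χ₀ ω)}) l (𝓝 0)) (k : ι)
    (hk : P {ω | χ₀ ω k = 0} = 0) {τ : α → Ω → ℝ}
    (hτ : ∀ T : ℝ, Tendsto (fun a => P {ω | τ a ω ≤ T}) l (𝓝 0)) {B : α → Set Ω}
    (hB : ∀ c > (0 : ℝ), ∀ M ≥ (0 : ℝ), ∃ T : ℝ, ∀ a ω, T < τ a ω → ‖χ a ω‖ ≤ M →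
      c ≤ |χ a ω k| → ω ∉ B a) :
    Tendsto (fun a => P (B a)) l (𝓝 0) := by
  refine ENNReal.tendsto_nhds_zero.mpr fun η hη => ?_
  have hη3 : 0 < η / 3 := ENNReal.div_pos hη.ne' (by simp)
  obtain ⟨n, hn⟩ := (ENNReal.tendsto_nhds_zero.mp
    (tendsto_measure_not_bounded_nondegenerate P hχ₀ k hk) _ hη3).exists
  set c : ℝ := 1 / ((n : ℝ) + 1) with hc
  have hc0 : 0 < c := by positivity
  obtain ⟨T, hT⟩ := hB (c / 2) (by positivity) (n + c / 2) (by positivity)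
  filter_upwards [ENNReal.tendsto_nhds_zero.mp (hχ (c / 2) (by positivity)) _ hη3,
    ENNReal.tendsto_nhds_zero.mp (hτ T) _ hη3] with a ha1 ha2
  have hsub : B a ⊆ ({ω | |χ₀ ω k| ≤ c ∨ (n : ℝ) ≤ ‖χ₀ ω‖} ∪
      {ω | c / 2 < dist (χ a ω) (χ₀ ω)}) ∪ {ω | τ a ω ≤ T} := by
    intro ω hω
    by_contra h
    simp only [Set.mem_union, Set.mem_ofPred_eq, not_or, not_le, not_lt] at h
    obtain ⟨⟨⟨h1, h2⟩, h3⟩, h4⟩ := h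
    have hcoord : |χ a ω k - χ₀ ω k| ≤ c / 2 := (dist_le_pi_dist (χ a ω) (χ₀ ω) k).trans h3
    refine hT a ω h4 ?_ ?_ hω
    · rw [dist_eq_norm] at h3
      linarith [norm_sub_norm_le (χ a ω) (χ₀ ω)]
    · rw [abs_sub_comm] at hcoord
      linarith [abs_sub_abs_le_abs_sub (χ₀ ω k) (χ a ω k)]
  calc P (B a) ≤ _ := measure_mono hsub
    _ ≤ η / 3 + η / 3 + η / 3 := (measure_union_le _ _).trans
        (add_le_add ((measure_union_le _ _).trans (add_le_add hn ha1)) ha2)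
    _ = η := ENNReal.add_thirds η

/- Here `χ ε ω` (coordinates indexed by `Fin d`, so that the paper's coordinate
`ξ^{(k)}`, `1 ≤ k ≤ d`, is `ξ ⟨k-1,_⟩`), and
`V_ε^{(i)} = ∑_{j=0}^{d-i} τ_ε^j / j! · χ_ε^{(i+j)}` is written as a sum over
`Fin d` indices `j' = i + j`.  Division by zero is `0` in `ℝ`, which implements the
convention that the ratio is `0` on the event `V_ε^{(1)} = 0`. -/
theorem stmt7 (d : ℕ) (hd : 2 ≤ d)
    {Ω : Type*} [MeasurableSpace Ω] (P : Measure Ω) [IsProbabilityMeasure P]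
    (χ : ℝ → Ω → Fin d → ℝ) (χ₀ : Ω → Fin d → ℝ)
    (hχmeas : ∀ ε : ℝ, Measurable (χ ε)) (hχ₀meas : Measurable χ₀)
    (hχconv : ∀ δ > (0 : ℝ),
      Filter.Tendsto (fun ε : ℝ => P {ω | δ < dist (χ ε ω) (χ₀ ω)}) (𝓝[>] (0 : ℝ)) (𝓝 0))
    (hχd : P {ω | χ₀ ω ⟨d - 1, by omega⟩ = 0} = 0)
    (τ : ℝ → Ω → ℝ) (hτmeas : ∀ ε : ℝ, Measurable (τ ε)) (hτpos : ∀ ε ω, 0 < τ ε ω)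
    (hτinf : ∀ T : ℝ, Filter.Tendsto (fun ε : ℝ => P {ω | τ ε ω ≤ T}) (𝓝[>] (0 : ℝ)) (𝓝 0))
    (V : ℝ → Ω → Fin d → ℝ)
    (hV : ∀ ε ω (i : Fin d), V ε ω i =
      ∑ j : Fin d, if (i : ℕ) ≤ (j : ℕ) then
        τ ε ω ^ ((j : ℕ) - (i : ℕ)) / Nat.factorial ((j : ℕ) - (i : ℕ)) * χ ε ω j
      else 0) :
    Filter.Tendsto (fun ε : ℝ => P {ω | V ε ω ⟨0, by omega⟩ = 0}) (𝓝[>] (0 : ℝ)) (𝓝 0)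
    ∧ ∀ i : Fin d, 1 ≤ (i : ℕ) → ∀ δ > (0 : ℝ),
        Filter.Tendsto (fun ε : ℝ => P {ω | δ < |V ε ω i / V ε ω ⟨0, by omega⟩|})
          (𝓝[>] (0 : ℝ)) (𝓝 0) := by
  obtain ⟨n, rfl⟩ : ∃ n, d = n + 2 := ⟨d - 2, by omega⟩
  refine ⟨tendsto_measure_zero_of_exclusion P hχ₀meas hχconv _ hχd hτinf fun c hc M hM => ?_,
    fun i hi δ hδ => tendsto_measure_zero_of_exclusion P hχ₀meas hχconv _ hχd hτinf
      fun c hc M hM => ?_⟩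
  · obtain ⟨T, hT⟩ := exists_forall_tail_ratio_le n hc one_pos hM
    exact ⟨T, fun ε ω ht hx hxc => (hT _ ht _ (V ε ω) hx hxc (hV ε ω)).1⟩
  · obtain ⟨T, hT⟩ := exists_forall_tail_ratio_le n hc hδ hM
    exact ⟨T, fun ε ω ht hx hxc => not_lt.mpr ((hT _ ht _ (V ε ω) hx hxc (hV ε ω)).2 i hi)⟩
end

section
/- Let $d\ge1$, $\lambda>0$, $\alpha\in(0,1)$. Let $(\chi_\varepsilon)_{\varepsilon\in(0,1)}$ be $\mathbb{R}^d$-valued random vectors converging in probability, as $\varepsilon\downarrow0$, to a random vector $\chi$ with $\mathrm P(\chi^{(d)}=0)=0$; let $(\tilde\tau_\varepsilon)$ be positive random variables with $\tilde\tau_\varepsilon\to\infty$ in probability; and let $(B_\varepsilon)$ be measurable events with $\mathrm P(B_\varepsilon)\to1$ such that on $B_\varepsilon$ one has $\varepsilon^{\alpha}=\varepsilon\,e^{\lambda\tilde\tau_\varepsilon}\,\big|\sum_{j=0}^{d-1}\frac{\tilde\tau_\varepsilon^{\,j}}{j!}\,\chi_\varepsilon^{(1+j)}\big|$. Define $G_\varepsilon=\log\big(|\chi_\varepsilon^{(d)}|\,(1-\alpha)^{d-1}/((d-1)!\,\lambda^{d-1})\big)$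 on the event $\chi_\varepsilon^{(d)}\neq0$ (and $G_\varepsilon=0$ otherwise). Then $\lambda\tilde\tau_\varepsilon-(1-\alpha)\log\varepsilon^{-1}+(d-1)\log\log\varepsilon^{-1}+G_\varepsilon\ \to\ 0$ in probability as $\varepsilon\downarrow0$. -/
open Filter Topology MeasureTheory

/-- `Gfun d α l x = log (|x| (1-α)^{d-1} / ((d-1)! λ^{d-1}))` when `x ≠ 0`, and `0` when
`x = 0`; it is applied to `x = χ_ε^{(d)}`. -/
noncomputable def Gfun (d : ℕ) (α l x : ℝ) : ℝ :=
  if x = 0 then 0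
  else Real.log (|x| * (1 - α) ^ (d - 1) / (Nat.factorial (d - 1) * l ^ (d - 1)))

/-- The polynomial factor `∑ j, t ^ j / j! * x j` in the exit equation. -/
noncomputable def duhamelSum (n : ℕ) (t : ℝ) (x : Fin (n + 1) → ℝ) : ℝ :=
  ∑ j : Fin (n + 1), t ^ (j : ℕ) / Nat.factorial (j : ℕ) * x j

/-- Bounded vectors whose last coordinate is bounded away from zero. -/
def nondegenerateVectors (n : ℕ) (M m : ℝ) : Set (Fin (n + 1) → ℝ) :=
  {x | ‖x‖ ≤ M ∧ m ≤ |x (Fin.last n)|}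

lemma measurableSet_nondegenerateVectors (n : ℕ) (M m : ℝ) :
    MeasurableSet (nondegenerateVectors n M m) :=
  (measurableSet_le measurable_norm measurable_const).inter
    (measurableSet_le measurable_const (measurable_pi_apply (Fin.last n)).abs)

lemma eventually_prod_principal_pos {X : Type*} (K : Set X) :
    ∀ᶠ p : ℝ × X in atTop ×ˢ 𝓟 K, 0 < p.1 ∧ p.2 ∈ K :=
  (eventually_gt_atTop 0).prod_mk (eventually_principal.2 fun _ h => h)

/-- A function vanishing at infinity times a function bounded on `K` vanishes in the limit,
uniformly on `K`. -/
lemma tendsto_mul_prod_principal_zero {X : Type*} {K : Set X} {f : ℝ → ℝ} {g : X → ℝ} {C : ℝ}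
    (hf : Tendsto f atTop (𝓝 0)) (hg : ∀ x ∈ K, |g x| ≤ C) :
    Tendsto (fun p : ℝ × X => f p.1 * g p.2) (atTop ×ˢ 𝓟 K) (𝓝 0) := by
  have h : Tendsto (fun p : ℝ × X => |f p.1| * C) (atTop ×ˢ 𝓟 K) (𝓝 0) := by
    simpa using ((hf.comp tendsto_fst).abs.mul_const C)
  refine squeeze_zero_norm' ?_ h
  filter_upwards [eventually_prod_principal_pos K] with p hp
  rw [Real.norm_eq_abs, abs_mul]
  exact mul_le_mul_of_nonneg_left (hg _ hp.2) (abs_nonneg _)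

lemma tendsto_duhamelSum_div_leading (n : ℕ) {M m : ℝ} (hm : 0 < m) :
    Tendsto (fun p : ℝ × (Fin (n + 1) → ℝ) => duhamelSum n p.1 p.2 /
        (p.1 ^ n / Nat.factorial n * p.2 (Fin.last n)))
      (atTop ×ˢ 𝓟 (nondegenerateVectors n M m)) (𝓝 1) := by
  have hterm : ∀ j : Fin n, Tendsto (fun p : ℝ × (Fin (n + 1) → ℝ) =>
      (p.1 ^ (j : ℕ) / p.1 ^ n) * (Nat.factorial n / Nat.factorial (j : ℕ) *
        (p.2 j.castSucc / p.2 (Fin.last n))))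
      (atTop ×ˢ 𝓟 (nondegenerateVectors n M m)) (𝓝 0) := by
    intro j
    refine tendsto_mul_prod_principal_zero
      (f := fun t : ℝ => t ^ (j : ℕ) / t ^ n)
      (g := fun x : Fin (n + 1) → ℝ => Nat.factorial n / Nat.factorial (j : ℕ) *
        (x j.castSucc / x (Fin.last n)))
      (C := Nat.factorial n / Nat.factorial (j : ℕ) * (M / m))
      (tendsto_pow_div_pow_atTop_zero j.2) ?_
    rintro x ⟨hxM, hxm⟩
    have hx : |x j.castSucc| ≤ M := (norm_le_pi_norm x j.castSucc).trans hxM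
    rw [abs_mul, abs_div (x _), abs_of_nonneg (a := (Nat.factorial n : ℝ) / _) (by positivity)]
    gcongr
    exact (abs_nonneg _).trans hx
  have hsum := (tendsto_finsetSum Finset.univ fun j _ => hterm j).add_const 1
  simp only [Finset.sum_const_zero, zero_add] at hsum
  refine hsum.congr' ?_
  filter_upwards [eventually_prod_principal_pos (nondegenerateVectors n M m)]
    with p ⟨ht, _, hxm⟩
  have hx : p.2 (Fin.last n) ≠ 0 := abs_pos.1 (hm.trans_le hxm)
  have hn : (Nat.factorial n : ℝ) ≠ 0 := by positivity
  rw [duhamelSum, Fin.sum_univ_castSucc, add_div, Finset.sum_div]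
  congr 1
  · refine Finset.sum_congr rfl fun j _ => ?_
    have hj : (Nat.factorial (j : ℕ) : ℝ) ≠ 0 := by positivity
    simp only [Fin.val_castSucc]
    field_simp
  · simp only [Fin.val_last]
    field_simp

/-- Expansion of `log |∑ j, t ^ j / j! * x j|` around its leading term, uniformly on
nondegenerate vectors. -/
lemma tendsto_log_duhamelSum_sub (n : ℕ) {M m : ℝ} (hm : 0 < m) :
    Tendsto (fun p : ℝ × (Fin (n + 1) → ℝ) => Real.log |duhamelSum n p.1 p.2| -
        (n * Real.log p.1 - Real.log (Nat.factorial n) + Real.log |p.2 (Fin.last n)|))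
      (atTop ×ˢ 𝓟 (nondegenerateVectors n M m)) (𝓝 0) := by
  have hR := tendsto_duhamelSum_div_leading n (M := M) hm
  have hlog := hR.log one_ne_zero
  rw [Real.log_one] at hlog
  refine hlog.congr' ?_
  filter_upwards [eventually_prod_principal_pos (nondegenerateVectors n M m),
    hR.eventually_ne one_ne_zero] with p ⟨ht, _, hxm⟩ hne
  have hx : p.2 (Fin.last n) ≠ 0 := abs_pos.1 (hm.trans_le hxm)
  have hn : (Nat.factorial n : ℝ) ≠ 0 := by positivity
  rw [Real.log_div (div_ne_zero_iff.1 hne).1 (div_ne_zero_iff.1 hne).2,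
    Real.log_mul (by positivity) hx, Real.log_div (by positivity) hn, Real.log_pow,
    Real.log_abs, Real.log_abs]

lemma tendsto_exitEquation_div (n : ℕ) {l M m : ℝ} (hl : 0 < l) (hm : 0 < m) :
    Tendsto (fun p : ℝ × (Fin (n + 1) → ℝ) =>
        (l * p.1 + Real.log |duhamelSum n p.1 p.2|) / (l * p.1))
      (atTop ×ˢ 𝓟 (nondegenerateVectors n M m)) (𝓝 1) := by
  set F := (atTop : Filter ℝ) ×ˢ 𝓟 (nondegenerateVectors n M m)
  have hinv : Tendsto (fun t : ℝ => t⁻¹) atTop (𝓝 0) := tendsto_inv_atTop_zero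
  have hlogdiv : Tendsto (fun t : ℝ => Real.log t / t) atTop (𝓝 0) := by
    simpa using Real.tendsto_pow_log_div_mul_add_atTop 1 0 1 one_ne_zero
  have h1 : Tendsto (fun p : ℝ × (Fin (n + 1) → ℝ) => Real.log p.1 / p.1) F (𝓝 0) :=
    hlogdiv.comp tendsto_fst
  have h0 : Tendsto (fun p : ℝ × (Fin (n + 1) → ℝ) => p.1⁻¹) F (𝓝 0) :=
    hinv.comp tendsto_fst
  have h2 : Tendsto (fun p : ℝ × (Fin (n + 1) → ℝ) =>
      p.1⁻¹ * Real.log |p.2 (Fin.last n)|) F (𝓝 0) := by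
    refine tendsto_mul_prod_principal_zero (f := fun t : ℝ => t⁻¹)
      (g := fun x : Fin (n + 1) → ℝ => Real.log |x (Fin.last n)|)
      (C := max |Real.log m| |Real.log M|) hinv ?_
    rintro x ⟨hxM, hxm⟩
    exact abs_le_max_abs_abs (Real.log_le_log hm hxm)
      (Real.log_le_log (hm.trans_le hxm) ((norm_le_pi_norm x (Fin.last n)).trans hxM))
  have h3 := tendsto_log_duhamelSum_sub n (M := M) hm
  have h := ((((h1.const_mul (n : ℝ)).sub (h0.mul_const (Real.log (Nat.factorial n)))).add
    h2).add (h0.mul h3)).const_mul l⁻¹ |>.const_add 1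
  simp only [mul_zero, zero_mul, sub_zero, add_zero] at h
  refine h.congr' ?_
  filter_upwards [eventually_prod_principal_pos (nondegenerateVectors n M m)] with p ⟨ht, _⟩
  field_simp
  ring

/-- Uniform asymptotics of the solution `t` of the exit equation
`(1 - α) L = l t + log |∑ j, t ^ j / j! * x j|`. -/
lemma tendsto_exitEquation_expansion (n : ℕ) {l α M m : ℝ} (hl : 0 < l) (hα : α < 1)
    (hm : 0 < m) :
    Tendsto (fun p : ℝ × (Fin (n + 1) → ℝ) =>
        -Real.log |duhamelSum n p.1 p.2| +
          n * Real.log ((l * p.1 + Real.log |duhamelSum n p.1 p.2|) / (1 - α)) +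
          Gfun (n + 1) α l (p.2 (Fin.last n)))
      (atTop ×ˢ 𝓟 (nondegenerateVectors n M m)) (𝓝 0) := by
  have hQ := tendsto_exitEquation_div n (M := M) hl hm
  have hlog := hQ.log one_ne_zero
  rw [Real.log_one] at hlog
  have h := (hlog.const_mul (n : ℝ)).sub (tendsto_log_duhamelSum_sub n (M := M) hm)
  simp only [mul_zero, sub_zero] at h
  refine h.congr' ?_
  filter_upwards [eventually_prod_principal_pos (nondegenerateVectors n M m),
    hQ.eventually_ne one_ne_zero] with p ⟨ht, _, hxm⟩ hne
  have hx : p.2 (Fin.last n) ≠ 0 := abs_pos.1 (hm.trans_le hxm)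
  have hn : (Nat.factorial n : ℝ) ≠ 0 := by positivity
  have hα' : 1 - α ≠ 0 := (sub_pos.2 hα).ne'
  have hnum := (div_ne_zero_iff.1 hne).1
  simp only [Gfun, if_neg hx, Nat.add_sub_cancel]
  rw [Real.log_div hnum (by positivity), Real.log_div hnum hα', Real.log_mul hl.ne' ht.ne',
    Real.log_div (mul_ne_zero (abs_ne_zero.2 hx) (pow_ne_zero _ hα')) (by positivity),
    Real.log_mul (abs_ne_zero.2 hx) (pow_ne_zero _ hα'), Real.log_mul hn (by positivity),
    Real.log_pow, Real.log_pow]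
  ring

lemma log_exitEquation {ε α l t S : ℝ} (hε : 0 < ε) (hα : α < 1)
    (h : ε ^ α = ε * Real.exp (l * t) * |S|) :
    Real.log ε⁻¹ = (l * t + Real.log |S|) / (1 - α) := by
  have hS : |S| ≠ 0 := by
    intro h0
    rw [h0, mul_zero] at h
    exact (Real.rpow_pos_of_pos hε α).ne' h
  have hlog := congrArg Real.log h
  rw [Real.log_rpow hε, Real.log_mul (by positivity) hS, Real.log_mul hε.ne' (by positivity),
    Real.log_exp] at hlog
  rw [Real.log_inv, eq_div_iff (sub_pos.2 hα).ne']
  linarith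

/-- A random vector with almost surely nonzero last coordinate is nondegenerate with
probability close to one. -/
lemma exists_measure_degenerate_le {Ω : Type*} [MeasurableSpace Ω] (P : Measure Ω)
    [IsFiniteMeasure P] {n : ℕ} {X : Ω → Fin (n + 1) → ℝ} (hX : Measurable X)
    (h0 : P {ω | X ω (Fin.last n) = 0} = 0) {η : ENNReal} (hη : 0 < η) :
    ∃ M m : ℝ, 0 < m ∧ P {ω | X ω ∉ nondegenerateVectors n M m} ≤ η := by
  let C : ℕ → Set Ω := fun k => {ω | X ω ∉ nondegenerateVectors n k (1 / ((k : ℝ) + 1))}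
  have hmeas : ∀ k, MeasurableSet (C k) := fun k =>
    (hX (measurableSet_nondegenerateVectors n k _)).compl
  have hanti : Antitone C := by
    intro i j hij ω hω hi
    have hij' : (i : ℝ) ≤ j := by exact_mod_cast hij
    exact hω ⟨hi.1.trans hij', (one_div_le_one_div_of_le (by positivity) (by linarith)).trans hi.2⟩
  have hinter : P (⋂ k, C k) = 0 := by
    refine measure_mono_null (fun ω hω => ?_) h0
    by_contra hne
    have h1 : ∀ᶠ k : ℕ in atTop, ‖X ω‖ ≤ k :=
      tendsto_natCast_atTop_atTop.eventually_ge_atTop _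
    have h2 : ∀ᶠ k : ℕ in atTop, 1 / ((k : ℝ) + 1) < |X ω (Fin.last n)| :=
      tendsto_one_div_add_atTop_nhds_zero_nat.eventually_lt_const (abs_pos.2 hne)
    obtain ⟨k, hk1, hk2⟩ := (h1.and h2).exists
    exact Set.mem_iInter.1 hω k ⟨hk1, hk2.le⟩
  have hlim : Tendsto (fun k => P (C k)) atTop (𝓝 0) := by
    have h := tendsto_measure_iInter_atTop (μ := P) (fun k => (hmeas k).nullMeasurableSet)
      hanti ⟨0, measure_ne_top _ _⟩
    rwa [hinter] at h
  obtain ⟨k, hk⟩ := (ENNReal.tendsto_nhds_zero.1 hlim η hη).exists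
  exact ⟨k, 1 / ((k : ℝ) + 1), by positivity, hk⟩

lemma mem_nondegenerateVectors_of_dist_le {n : ℕ} {M m : ℝ} {x y : Fin (n + 1) → ℝ}
    (hy : y ∈ nondegenerateVectors n M m) (h : dist x y ≤ m / 2) :
    x ∈ nondegenerateVectors n (M + m / 2) (m / 2) := by
  rw [dist_eq_norm] at h
  have h1 := norm_le_norm_add_norm_sub' x y
  have h2 : |(x - y) (Fin.last n)| ≤ m / 2 := (norm_le_pi_norm (x - y) _).trans h
  have h3 := abs_sub_abs_le_abs_sub (y (Fin.last n)) (x (Fin.last n))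
  rw [abs_sub_comm] at h3
  rw [Pi.sub_apply] at h2
  exact ⟨by linarith [hy.1], by linarith [hy.2]⟩

/- Coordinates are indexed by `Fin d`: the paper's `ξ^{(k)}` is `ξ ⟨k-1,_⟩`; in particular
`χ_ε^{(1+j)}`, `j = 0, …, d-1`, is `χ ε ω j` for `j : Fin d`.  Limits as `ε ↓ 0` are taken
along `𝓝[>] 0`. -/
theorem stmt8 (d : ℕ) (hd : 1 ≤ d) (l α : ℝ) (hl : 0 < l) (hα : α ∈ Set.Ioo (0 : ℝ) 1)
    {Ω : Type*} [MeasurableSpace Ω] (P : Measure Ω) [IsProbabilityMeasure P]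
    (χ : ℝ → Ω → Fin d → ℝ) (χ₀ : Ω → Fin d → ℝ)
    (hχmeas : ∀ ε : ℝ, Measurable (χ ε)) (hχ₀meas : Measurable χ₀)
    (hχconv : ∀ δ > (0 : ℝ),
      Filter.Tendsto (fun ε : ℝ => P {ω | δ < dist (χ ε ω) (χ₀ ω)}) (𝓝[>] (0 : ℝ)) (𝓝 0))
    (hχd : P {ω | χ₀ ω ⟨d - 1, by omega⟩ = 0} = 0)
    (τ : ℝ → Ω → ℝ) (hτmeas : ∀ ε : ℝ, Measurable (τ ε)) (hτpos : ∀ ε ω, 0 < τ ε ω)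
    (hτinf : ∀ T : ℝ, Filter.Tendsto (fun ε : ℝ => P {ω | τ ε ω ≤ T}) (𝓝[>] (0 : ℝ)) (𝓝 0))
    (B : ℝ → Set Ω) (hBmeas : ∀ ε : ℝ, MeasurableSet (B ε))
    (hB1 : Filter.Tendsto (fun ε : ℝ => P (B ε)) (𝓝[>] (0 : ℝ)) (𝓝 1))
    (hBeq : ∀ ε ∈ Set.Ioo (0 : ℝ) 1, ∀ ω ∈ B ε,
      ε ^ α = ε * Real.exp (l * τ ε ω) *
        |∑ j : Fin d, τ ε ω ^ (j : ℕ) / Nat.factorial (j : ℕ) * χ ε ω j|) :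
    ∀ δ > (0 : ℝ),
      Filter.Tendsto
        (fun ε : ℝ => P {ω | δ <
          |l * τ ε ω - (1 - α) * Real.log ε⁻¹ +
            ((d : ℝ) - 1) * Real.log (Real.log ε⁻¹) +
            Gfun d α l (χ ε ω ⟨d - 1, by omega⟩)|})
        (𝓝[>] (0 : ℝ)) (𝓝 0) := by
  intro δ hδ
  obtain ⟨n, rfl⟩ : ∃ n, d = n + 1 := ⟨d - 1, by omega⟩
  have hα1 := hα.2
  have hα0 : 1 - α ≠ 0 := (sub_pos.2 hα1).ne'
  rw [ENNReal.tendsto_nhds_zero]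
  intro η hη
  obtain ⟨M, m, hm, hC⟩ := exists_measure_degenerate_le P hχ₀meas hχd (ENNReal.half_pos hη.ne')
  have hunif := tendsto_exitEquation_expansion n (M := M + m / 2) hl hα1 (half_pos hm)
  obtain ⟨T, hT⟩ : ∃ T : ℝ, ∀ t ≥ T, ∀ x ∈ nondegenerateVectors n (M + m / 2) (m / 2),
      |-Real.log |duhamelSum n t x| +
          n * Real.log ((l * t + Real.log |duhamelSum n t x|) / (1 - α)) +
          Gfun (n + 1) α l (x (Fin.last n))| < δ := by
    have h := hunif.abs.eventually_lt_const (u := δ) (by simpa using hδ)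
    rw [eventually_prod_principal_iff] at h
    exact eventually_atTop.1 h
  have hBc : Tendsto (fun ε : ℝ => P (B ε)ᶜ) (𝓝[>] (0 : ℝ)) (𝓝 0) := by
    have h := ENNReal.Tendsto.sub (tendsto_const_nhds (x := (1 : ENNReal))) hB1 (by simp)
    rw [tsub_self] at h
    exact h.congr fun ε => (prob_compl_eq_one_sub (hBmeas ε)).symm
  have hrest := ((hχconv (m / 2) (half_pos hm)).add (hτinf T)).add hBc
  simp only [add_zero] at hrest
  filter_upwards [ENNReal.tendsto_nhds_zero.1 hrest (η / 2) (ENNReal.half_pos hη.ne'),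
    Ioo_mem_nhdsGT (zero_lt_one' ℝ)] with ε hε hεIoo
  calc _ ≤ P ({ω | χ₀ ω ∉ nondegenerateVectors n M m} ∪
        (({ω | m / 2 < dist (χ ε ω) (χ₀ ω)} ∪ {ω | τ ε ω ≤ T}) ∪ (B ε)ᶜ)) := by
        refine measure_mono fun ω hω => ?_
        by_contra hgood
        simp only [Set.mem_union, Set.mem_ofPred_eq, Set.mem_compl_iff, not_or, not_not, not_lt,
          not_le] at hgood
        obtain ⟨hy, ⟨hd', ht⟩, hB⟩ := hgood
        have hbound := hT _ ht.le _ (mem_nondegenerateVectors_of_dist_le hy hd')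
        have hL := log_exitEquation (S := duhamelSum n (τ ε ω) (χ ε ω)) hεIoo.1 hα1
          (hBeq ε hεIoo ω hB)
        refine lt_asymm hbound (lt_of_lt_of_eq hω (congrArg abs ?_))
        rw [hL, mul_div_cancel₀ _ hα0, Nat.cast_add, Nat.cast_one, add_sub_cancel_right]
        change _ + Gfun (n + 1) α l (χ ε ω (Fin.last n)) = _
        ring
    _ ≤ P {ω | χ₀ ω ∉ nondegenerateVectors n M m} +
        ((P {ω | m / 2 < dist (χ ε ω) (χ₀ ω)} + P {ω | τ ε ω ≤ T}) + P (B ε)ᶜ) := by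
        refine (measure_union_le _ _).trans ?_
        gcongr
        refine (measure_union_le _ _).trans ?_
        gcongr
        exact measure_union_le _ _
    _ ≤ η / 2 + η / 2 := add_le_add hC hε
    _ = η := ENNReal.add_halves η
end

section
/- Let $d\ge1$, $\lambda>0$, $\alpha\in(0,1)$. Let $(\chi_\varepsilon)_{\varepsilon\in(0,1)}$ be $\mathbb{R}^d$-valued random vectors converging in probability, as $\varepsilon\downarrow0$, to a random vector $\chi$ with $\mathrm P(\chi^{(d)}=0)=0$; let $(\tilde\tau_\varepsilon)$ be positive random variables with $\tilde\tau_\varepsilon\to\infty$ in probability; and let $(B_\varepsilon)$ be measurable events with $\mathrm P(B_\varepsilon)\to1$ such that on $B_\varepsilon$ one has $\varepsilon^{\alpha}=\varepsilon\,e^{\lambda\tilde\tau_\varepsilon}\,\big|\sum_{j=0}^{d-1}\frac{\tilde\tau_\varepsilon^{\,j}}{j!}\,\chi_\varepsilon^{(1+j)}\big|$. On the event $\chi_\varepsilon^{(d)}\neq0$ define $G_\varepsilon=\log\big(|\chi_\varepsilon^{(d)}|\,(1-\alpha)^{d-1}/((d-1)!\,\lambda^{d-1})\big)$, $\eta_\varepsilon=-\lambda\,\chi_\varepsilon^{(d-1)}/\chi_\varepsilon^{(d)}+G_\varepsilon$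 (with the convention $\chi_\varepsilon^{(0)}=0$ when $d=1$, and $G_\varepsilon=\eta_\varepsilon=0$ when $\chi_\varepsilon^{(d)}=0$), and $\tilde K(\varepsilon)=\lambda\tilde\tau_\varepsilon-(1-\alpha)\log\varepsilon^{-1}+(d-1)\log\log\varepsilon^{-1}+G_\varepsilon$. Then $\log\varepsilon^{-1}\cdot\Big(\tilde K(\varepsilon)-\frac{(d-1)^2}{1-\alpha}\,\frac{\log\log\varepsilon^{-1}}{\log\varepsilon^{-1}}-\frac{(d-1)\,\eta_\varepsilon}{(1-\alpha)\,\log\varepsilon^{-1}}\Big)\ \to\ 0$ in probability as $\varepsilon\downarrow0$. -/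
open Filter Topology MeasureTheory

/-- `etafun d α l x' x = -λ x'/x + Gfun d α l x` when `x ≠ 0`, and `0` when `x = 0`;
it is applied to `x' = χ_ε^{(d-1)}` (with the convention `χ_ε^{(0)} = 0` for `d = 1`)
and `x = χ_ε^{(d)}`. -/
noncomputable def etafun (d : ℕ) (α l x' x : ℝ) : ℝ :=
  if x = 0 then 0 else -l * x' / x + Gfun d α l x

open Asymptotics in
lemma tendsto_mul_zero_of_isBigO_one {ι : Type*} {F : Filter ι} {f g : ι → ℝ}
    (hf : f =O[F] (fun _ => (1 : ℝ))) (hg : Tendsto g F (𝓝 0)) :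
    Tendsto (fun i => f i * g i) F (𝓝 0) := by
  rw [← isLittleO_one_iff ℝ] at hg ⊢
  simpa using hf.mul_isLittleO hg

lemma abs_log_sub_sub_one_le {t : ℝ} (ht : 1 / 2 ≤ t) :
    |Real.log t - (t - 1)| ≤ 2 * (t - 1) ^ 2 := by
  have h0 : 0 < t := by linarith
  have h1 := Real.log_le_sub_one_of_pos h0
  have h2 := Real.one_sub_inv_le_log_of_pos h0
  have h3 : 1 - t⁻¹ - (t - 1) = -((t - 1) ^ 2 * t⁻¹) := by field_simp; ring
  have h4 : t⁻¹ ≤ 2 := by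
    rw [inv_le_comm₀ h0 two_pos]; linarith
  have h5 : (t - 1) ^ 2 * t⁻¹ ≤ (t - 1) ^ 2 * 2 :=
    mul_le_mul_of_nonneg_left h4 (sq_nonneg _)
  rw [abs_le]
  constructor <;> nlinarith [sq_nonneg (t - 1)]

/-- If `t → 1` and `c (t - 1)² → 0`, then `log t` may be replaced by `t - 1` at scale `c⁻¹`. -/
lemma tendsto_mul_log_sub_sub_one {ι : Type*} {F : Filter ι} {c t : ι → ℝ}
    (ht : Tendsto t F (𝓝 1)) (hc : Tendsto (fun i => c i * (t i - 1) ^ 2) F (𝓝 0)) :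
    Tendsto (fun i => c i * (Real.log (t i) - (t i - 1))) F (𝓝 0) := by
  have h2 : Tendsto (fun i => 2 * |c i * (t i - 1) ^ 2|) F (𝓝 0) := by
    simpa using (hc.abs.const_mul 2)
  refine squeeze_zero_norm' ?_ h2
  filter_upwards [ht.eventually_const_le (show (1 / 2 : ℝ) < 1 by norm_num)] with i hi
  rw [Real.norm_eq_abs, abs_mul, abs_mul, abs_of_nonneg (sq_nonneg (t i - 1))]
  nlinarith [abs_log_sub_sub_one_le hi, abs_nonneg (c i)]

open Asymptotics in
/-- Asymptotic inversion of `l τ + log (|A| τⁿ ρ / n!) = b L` up to order `o(1 / L)`. -/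
lemma tendsto_expansion_of_log_eq {ι : Type*} {F : Filter ι} (n : ℕ) {l b : ℝ} (hl : 0 < l)
    (hb : 0 < b) {L τ ρ r A : ι → ℝ} (hL : Tendsto L F atTop) (hτ : Tendsto τ F atTop)
    (hA : (fun i => Real.log |A i|) =O[F] (fun _ => (1 : ℝ))) (hr : r =O[F] (fun _ => (1 : ℝ)))
    (hρ : Tendsto (fun i => τ i * (ρ i - 1) - n * r i) F (𝓝 0))
    (heq : ∀ᶠ i in F, l * τ i + (Real.log |A i| + n * Real.log (τ i)
      - Real.log n.factorial + Real.log (ρ i)) = b * L i) :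
    Tendsto (fun i => L i * ((l * τ i - b * L i + n * Real.log (L i) +
        (Real.log |A i| + n * Real.log b - Real.log n.factorial - n * Real.log l)) -
      (n : ℝ) ^ 2 / b * (Real.log (L i) / L i) -
      n * (-l * r i + (Real.log |A i| + n * Real.log b - Real.log n.factorial
        - n * Real.log l)) / (b * L i))) F (𝓝 0) := by
  have hτinv : Tendsto (fun i => (τ i)⁻¹) F (𝓝 0) := tendsto_inv_atTop_zero.comp hτ
  have hLinv : Tendsto (fun i => (L i)⁻¹) F (𝓝 0) := tendsto_inv_atTop_zero.comp hL
  have hτ0 := hτ.eventually_gt_atTop 0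
  have hL0 := hL.eventually_gt_atTop 0
  have hconst : ∀ c : ℝ, (fun _ : ι => c) =O[F] (fun _ => (1 : ℝ)) :=
    fun c => isBigO_const_const c one_ne_zero F
  have hnr : (fun i => (n : ℝ) * r i) =O[F] (fun _ => (1 : ℝ)) := hr.const_mul_left _
  have hτρ : (fun i => τ i * (ρ i - 1)) =O[F] (fun _ => (1 : ℝ)) := by
    have := ((isLittleO_one_iff ℝ).2 hρ).isBigO.add hnr
    simpa using this
  have hρ0 : Tendsto (fun i => ρ i - 1) F (𝓝 0) := by
    refine (tendsto_mul_zero_of_isBigO_one hτρ hτinv).congr' ?_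
    filter_upwards [hτ0] with i hi
    field_simp
  have hρ1 : Tendsto ρ F (𝓝 1) := by simpa using hρ0.add_const 1
  have hlogρ : Tendsto (fun i => Real.log (ρ i)) F (𝓝 0) := by
    simpa using hρ1.log one_ne_zero
  have hτlogρ : Tendsto (fun i => τ i * Real.log (ρ i) - n * r i) F (𝓝 0) := by
    have h1 : Tendsto (fun i => τ i * (ρ i - 1) ^ 2) F (𝓝 0) := by
      refine (tendsto_mul_zero_of_isBigO_one hτρ hρ0).congr fun i => by ring
    have := (tendsto_mul_log_sub_sub_one hρ1 h1).add hρ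
    rw [add_zero] at this
    exact this.congr fun i => by ring
  set G : ι → ℝ := fun i => Real.log |A i| + n * Real.log b - Real.log n.factorial
    - n * Real.log l with hGdef
  have hG : G =O[F] (fun _ => (1 : ℝ)) :=
    ((hA.add (hconst _)).sub (hconst _)).sub (hconst _)
  have hlogdiv : Tendsto (fun x : ℝ => Real.log x / x) atTop (𝓝 0) :=
    Real.isLittleO_log_id_atTop.tendsto_div_nhds_zero
  -- the ratio `τ / L` converges to `b / l`
  have huinv : Tendsto (fun i => b * L i / (l * τ i)) F (𝓝 1) := by
    have h1 : Tendsto (fun i => 1 + l⁻¹ * ((Real.log |A i| - Real.log n.factorial +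
        Real.log (ρ i)) * (τ i)⁻¹ + n * (Real.log (τ i) / τ i))) F
        (𝓝 (1 + l⁻¹ * (0 + n * 0))) := by
      refine tendsto_const_nhds.add (((?_ : Tendsto _ _ _).add
        ((hlogdiv.comp hτ).const_mul _)).const_mul _)
      exact tendsto_mul_zero_of_isBigO_one
        ((hA.sub (hconst _)).add ((isLittleO_one_iff ℝ).2 hlogρ).isBigO) hτinv
    simp only [mul_zero, add_zero] at h1
    refine h1.congr' ?_
    filter_upwards [heq, hτ0] with i hi h0
    rw [← hi]
    field_simp
    ring
  set u : ι → ℝ := fun i => l * τ i / (b * L i) with hudef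
  have hu : Tendsto u F (𝓝 1) := by
    have := huinv.inv₀ one_ne_zero
    simpa [hudef] using this
  have hLτ : Tendsto (fun i => L i / τ i) F (𝓝 (l / b)) := by
    have := huinv.const_mul (l / b)
    rw [mul_one] at this
    refine this.congr fun i => ?_
    field_simp
  have hlogu : Tendsto (fun i => Real.log (u i)) F (𝓝 0) := by
    simpa using hu.log one_ne_zero
  set K : ι → ℝ := fun i => l * τ i - b * L i + n * Real.log (L i) + G i with hKdef
  have hKeq : ∀ᶠ i in F, K i = -(n * Real.log (u i)) - Real.log (ρ i) := by
    filter_upwards [heq, hτ0, hL0] with i hi h0 h1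
    have : Real.log (u i) = Real.log l + Real.log (τ i) - (Real.log b + Real.log (L i)) := by
      simp only [hudef]
      rw [Real.log_div (by positivity) (by positivity), Real.log_mul hl.ne' h0.ne',
        Real.log_mul hb.ne' h1.ne']
    simp only [hKdef, hGdef]
    rw [this, ← hi]
    ring
  have hK : Tendsto K F (𝓝 0) := by
    have : Tendsto (fun i => -(n * Real.log (u i)) - Real.log (ρ i)) F
        (𝓝 (-(n * 0) - 0)) := (hlogu.const_mul _).neg.sub hlogρ
    simp only [mul_zero, neg_zero, sub_zero] at this
    exact this.congr' (hKeq.mono fun i hi => hi.symm)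
  have hu1 : ∀ᶠ i in F, u i - 1 = (K i - n * Real.log (L i) - G i) / (b * L i) := by
    filter_upwards [hL0] with i h1
    simp only [hudef, hKdef]
    field_simp
    ring
  have hLu : Tendsto (fun i => L i * (u i - 1) ^ 2) F (𝓝 0) := by
    have hH : (fun i => K i - G i) =O[F] (fun _ => (1 : ℝ)) :=
      ((isLittleO_one_iff ℝ).2 hK).isBigO.sub hG
    have hpow : Tendsto (fun i => Real.log (L i) ^ 2 / L i) F (𝓝 0) :=
      ((Real.isLittleO_pow_log_id_atTop (n := 2)).tendsto_div_nhds_zero).comp hL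
    have h1 : Tendsto (fun i => (b ^ 2)⁻¹ * ((K i - G i) ^ 2 * (L i)⁻¹
        - 2 * n * ((K i - G i) * (Real.log (L i) / L i))
        + n ^ 2 * (Real.log (L i) ^ 2 / L i))) F
        (𝓝 ((b ^ 2)⁻¹ * (0 - 2 * n * 0 + n ^ 2 * 0))) := by
      refine (((tendsto_mul_zero_of_isBigO_one ?_ hLinv).sub
        ((tendsto_mul_zero_of_isBigO_one hH (hlogdiv.comp hL)).const_mul _)).add
        (hpow.const_mul _)).const_mul _
      simpa using hH.pow 2
    simp only [mul_zero, sub_zero, add_zero] at h1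
    refine h1.congr' ?_
    filter_upwards [hu1, hL0] with i hi h0
    rw [hi]
    field_simp
    ring
  have hLlogu := tendsto_mul_log_sub_sub_one hu hLu
  have hLlogρ : Tendsto (fun i => L i * Real.log (ρ i) - l / b * (n * r i)) F (𝓝 0) := by
    have h1 := hLτ.mul hτlogρ
    have h2 : Tendsto (fun i => L i / τ i - l / b) F (𝓝 0) := by
      simpa using hLτ.sub_const (l / b)
    have h3 := h1.add (tendsto_mul_zero_of_isBigO_one hnr h2)
    simp only [mul_zero, add_zero] at h3
    refine h3.congr' ?_
    filter_upwards [hτ0] with i h0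
    field_simp
    ring
  have hfin := ((hLlogu.const_mul (-(n : ℝ))).sub (hK.const_mul (n / b))).sub hLlogρ
  simp only [mul_zero, sub_zero] at hfin
  refine hfin.congr' ?_
  filter_upwards [hKeq, hu1, hL0] with i hi h1 h0
  change _ = L i * (K i - (n : ℝ) ^ 2 / b * (Real.log (L i) / L i) -
    n * (-l * r i + G i) / (b * L i))
  have hlog : Real.log (ρ i) = -(n * Real.log (u i)) - K i := by linarith
  rw [hlog, h1]
  field_simp
  ring

open Asymptotics in
/-- The normalized polynomial `∑ τʲ xⱼ / j!` equals `1 + n r / τ + o(1 / τ)`, where `r` is the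
ratio of the last two coefficients. -/
lemma tendsto_normalized_sum {ι : Type*} {F : Filter ι} (m : ℕ) {τ : ι → ℝ}
    {x : ι → Fin (m + 2) → ℝ} (hτ : Tendsto τ F atTop)
    (hx0 : ∀ᶠ i in F, x i (Fin.last (m + 1)) ≠ 0)
    (hx : ∀ j, (fun i => x i j / x i (Fin.last (m + 1))) =O[F] (fun _ => (1 : ℝ))) :
    Tendsto (fun i => τ i * ((∑ j : Fin (m + 2), τ i ^ (j : ℕ) / (j : ℕ).factorial * x i j) /
        (τ i ^ (m + 1) / (m + 1).factorial * x i (Fin.last (m + 1))) - 1)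
      - ((m + 1 : ℕ) : ℝ) * (x i (Fin.last m).castSucc / x i (Fin.last (m + 1)))) F (𝓝 0) := by
  have h1 : Tendsto (fun i => ∑ j : Fin m, ((m + 1).factorial / (j : ℕ).factorial : ℝ) *
      ((x i j.castSucc.castSucc / x i (Fin.last (m + 1))) * (τ i ^ (j : ℕ) / τ i ^ m)))
      F (𝓝 (∑ j : Fin m, ((m + 1).factorial / (j : ℕ).factorial : ℝ) * 0)) := by
    refine tendsto_finsetSum _ fun j _ => Tendsto.const_mul _ ?_
    exact tendsto_mul_zero_of_isBigO_one (hx _)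
      ((isLittleO_pow_pow_atTop_of_lt j.2).tendsto_div_nhds_zero.comp hτ)
  simp only [mul_zero, Finset.sum_const_zero] at h1
  refine h1.congr' ?_
  filter_upwards [hx0, hτ.eventually_gt_atTop 0] with i hi h0
  have hf : ((m + 1).factorial : ℝ) ≠ 0 := by positivity
  have hm : (m.factorial : ℝ) ≠ 0 := by positivity
  rw [Fin.sum_univ_castSucc, Fin.sum_univ_castSucc]
  simp only [Fin.val_castSucc, Fin.val_last]
  rw [add_div, div_self (by positivity), add_sub_cancel_right, add_div, mul_add,
    Finset.sum_div, Finset.mul_sum]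
  have h2 : τ i * (τ i ^ m / m.factorial * x i (Fin.last m).castSucc /
      (τ i ^ (m + 1) / (m + 1).factorial * x i (Fin.last (m + 1)))) =
      ((m + 1 : ℕ) : ℝ) * (x i (Fin.last m).castSucc / x i (Fin.last (m + 1))) := by
    rw [Nat.factorial_succ]
    push_cast
    field_simp
    ring
  rw [h2, add_sub_cancel_right]
  refine Finset.sum_congr rfl fun j _ => ?_
  field_simp
  ring

/-- The rescaled remainder of the expansion of the exit time, as a function of the noise
level `ε`, the exit time `t` and the vector `x`. -/
noncomputable def exitRemainder (n : ℕ) (l α ε t : ℝ) (x : Fin (n + 1) → ℝ) : ℝ :=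
  Real.log ε⁻¹ *
    ((l * t - (1 - α) * Real.log ε⁻¹ + (((n + 1 : ℕ) : ℝ) - 1) * Real.log (Real.log ε⁻¹) +
        Gfun (n + 1) α l (x (Fin.last n))) -
      (((n + 1 : ℕ) : ℝ) - 1) ^ 2 / (1 - α) * (Real.log (Real.log ε⁻¹) / Real.log ε⁻¹) -
      (((n + 1 : ℕ) : ℝ) - 1) *
        etafun (n + 1) α l (if h : 2 ≤ n + 1 then x ⟨n + 1 - 2, by omega⟩ else 0)
          (x (Fin.last n)) /
        ((1 - α) * Real.log ε⁻¹))

lemma Gfun_succ_eq (n : ℕ) {l α x : ℝ} (hl : 0 < l) (hα : α < 1) (hx : x ≠ 0) :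
    Gfun (n + 1) α l x = Real.log |x| + n * Real.log (1 - α) - Real.log n.factorial
      - n * Real.log l := by
  have hb : 0 < 1 - α := by linarith
  have hf : (n.factorial : ℝ) ≠ 0 := by positivity
  rw [Gfun, if_neg hx, Nat.add_sub_cancel, Real.log_div (by positivity) (by positivity),
    Real.log_mul (by positivity) (by positivity), Real.log_mul hf (by positivity),
    Real.log_pow, Real.log_pow]
  ring

open Asymptotics in
lemma tendsto_exitRemainder {ι : Type*} {F : Filter ι} (n : ℕ) {l α M : ℝ}
    (hl : 0 < l) (hα : α < 1) (hM : 0 < M) {ε τ : ι → ℝ} {x : ι → Fin (n + 1) → ℝ}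
    (hε : Tendsto ε F (𝓝[>] 0)) (hτ : Tendsto τ F atTop)
    (hxM : ∀ᶠ i in F, ∀ j, |x i j| ≤ M) (hxm : ∀ᶠ i in F, M⁻¹ ≤ |x i (Fin.last n)|)
    (heq : ∀ᶠ i in F, ε i ^ α = ε i * Real.exp (l * τ i) *
        |∑ j : Fin (n + 1), τ i ^ (j : ℕ) / Nat.factorial (j : ℕ) * x i j|) :
    Tendsto (fun i => exitRemainder n l α (ε i) (τ i) (x i)) F (𝓝 0) := by
  have hb : 0 < 1 - α := by linarith
  have hx0 : ∀ᶠ i in F, x i (Fin.last n) ≠ 0 := by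
    filter_upwards [hxm] with i hi h0
    rw [h0, abs_zero] at hi
    exact absurd (inv_pos.2 hM) (not_lt.2 hi)
  have hlog : (fun i => Real.log |x i (Fin.last n)|) =O[F] (fun _ => (1 : ℝ)) := by
    refine IsBigO.of_bound |Real.log M| ?_
    filter_upwards [hxM, hxm, hx0] with i h1 h2 h3
    have h4 := Real.log_le_log (abs_pos.2 h3) (h1 (Fin.last n))
    have h5 := Real.log_le_log (inv_pos.2 hM) h2
    rw [Real.log_inv] at h5
    rw [Real.norm_eq_abs, norm_one, mul_one, abs_le]
    constructor <;> linarith [le_abs_self (Real.log M)]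
  have hratio : ∀ j, (fun i => x i j / x i (Fin.last n)) =O[F] (fun _ => (1 : ℝ)) := by
    intro j
    refine IsBigO.of_bound (M * M) ?_
    filter_upwards [hxM, hxm] with i h1 h2
    rw [Real.norm_eq_abs, norm_one, mul_one, abs_div, div_eq_mul_inv]
    have h3 : |x i (Fin.last n)|⁻¹ ≤ M := inv_le_of_inv_le₀ hM h2
    exact mul_le_mul (h1 j) h3 (by positivity) hM.le
  have hL : Tendsto (fun i => Real.log (ε i)⁻¹) F atTop :=
    Real.tendsto_log_atTop.comp (tendsto_inv_nhdsGT_zero.comp hε)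
  have hε0 : ∀ᶠ i in F, 0 < ε i := hε.eventually self_mem_nhdsWithin
  set ρ : ι → ℝ := fun i => (∑ j : Fin (n + 1), τ i ^ (j : ℕ) / (j : ℕ).factorial * x i j) /
        (τ i ^ n / n.factorial * x i (Fin.last n)) with hρdef
  set r : ι → ℝ := fun i => (if h : 2 ≤ n + 1 then x i ⟨n + 1 - 2, by omega⟩ else 0) /
    x i (Fin.last n) with hrdef
  have hr : r =O[F] (fun _ => (1 : ℝ)) := by
    by_cases h : 2 ≤ n + 1
    · simpa only [hrdef, dif_pos h] using hratio _
    · simpa only [hrdef, dif_neg h, zero_div] using isBigO_zero _ _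
  have hρ : Tendsto (fun i => τ i * (ρ i - 1) - n * r i) F (𝓝 0) := by
    rcases n with _ | m
    · refine tendsto_const_nhds.congr' ?_
      filter_upwards [hx0] with i hi
      have hi' : x i 0 ≠ 0 := hi
      simp [hρdef, hi']
    · have h2 : 2 ≤ m + 1 + 1 := by omega
      simp only [hrdef, dif_pos h2]
      exact tendsto_normalized_sum m hτ hx0 hratio
  have hlogeq : ∀ᶠ i in F, l * τ i + (Real.log |x i (Fin.last n)| + n * Real.log (τ i)
      - Real.log n.factorial + Real.log (ρ i)) = (1 - α) * Real.log (ε i)⁻¹ := by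
    filter_upwards [heq, hε0, hx0, hτ.eventually_gt_atTop 0] with i hi h0 h1 h2
    set S := ∑ j : Fin (n + 1), τ i ^ (j : ℕ) / (j : ℕ).factorial * x i j with hS
    have hf : (n.factorial : ℝ) ≠ 0 := by positivity
    have hS0 : S ≠ 0 := by
      intro h
      rw [h, abs_zero, mul_zero] at hi
      exact (Real.rpow_pos_of_pos h0 α).ne' hi
    have h3 := congrArg Real.log hi
    rw [Real.log_rpow h0, Real.log_mul (by positivity) (by positivity),
      Real.log_mul h0.ne' (by positivity), Real.log_exp, Real.log_abs] at h3
    have h4 : Real.log (ρ i) = Real.log S - (n * Real.log (τ i) - Real.log n.factorial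
        + Real.log (x i (Fin.last n))) := by
      simp only [hρdef]
      rw [Real.log_div hS0 (by positivity), Real.log_mul (by positivity) h1,
        Real.log_div (by positivity) hf, Real.log_pow]
    rw [h4, Real.log_abs, Real.log_inv]
    linarith
  refine (tendsto_expansion_of_log_eq n hl hb hL hτ hlog hr hρ hlogeq).congr' ?_
  filter_upwards [hx0] with i hi
  have hn : ((n + 1 : ℕ) : ℝ) - 1 = n := by push_cast; ring
  simp only [exitRemainder, etafun, if_neg hi, Gfun_succ_eq n hl hα hi, hn, hrdef,
    mul_div_assoc]

/-- Uniform smallness of the remainder over vectors in a compact set on which the last coordinate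
does not vanish. -/
lemma exists_forall_abs_exitRemainder_le (n : ℕ) {l α M δ : ℝ}
    (hl : 0 < l) (hα : α < 1) (hM : 0 < M) (hδ : 0 < δ) :
    ∃ T : ℝ, ∀ᶠ ε in 𝓝[>] (0 : ℝ), ∀ t > T, ∀ x : Fin (n + 1) → ℝ, (∀ j, |x j| ≤ M) →
      M⁻¹ ≤ |x (Fin.last n)| →
      ε ^ α = ε * Real.exp (l * t) *
        |∑ j : Fin (n + 1), t ^ (j : ℕ) / Nat.factorial (j : ℕ) * x j| →
      |exitRemainder n l α ε t x| ≤ δ := by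
  set S : Set (ℝ × ℝ × (Fin (n + 1) → ℝ)) := {p | (∀ j, |p.2.2 j| ≤ M) ∧
      M⁻¹ ≤ |p.2.2 (Fin.last n)| ∧ p.1 ^ α = p.1 * Real.exp (l * p.2.1) *
        |∑ j : Fin (n + 1), p.2.1 ^ (j : ℕ) / Nat.factorial (j : ℕ) * p.2.2 j|}
  set F : Filter (ℝ × ℝ × (Fin (n + 1) → ℝ)) := 𝓝[>] (0 : ℝ) ×ˢ (atTop : Filter ℝ) ×ˢ ⊤
  have hS : ∀ᶠ p in F ⊓ 𝓟 S, p ∈ S := mem_inf_of_right (mem_principal_self S)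
  have h := tendsto_exitRemainder (F := F ⊓ 𝓟 S) n hl hα hM (ε := fun p => p.1)
    (τ := fun p => p.2.1) (x := fun p => p.2.2) (tendsto_fst.mono_left inf_le_left)
    ((tendsto_fst.comp tendsto_snd).mono_left inf_le_left) (hS.mono fun p hp => hp.1)
    (hS.mono fun p hp => hp.2.1) (hS.mono fun p hp => hp.2.2)
  have h1 := h.abs.eventually_le_const (u := δ) (by simpa using hδ)
  rw [eventually_inf_principal, eventually_prod_iff] at h1
  obtain ⟨p₁, hp₁, p₂, hp₂, hp⟩ := h1
  obtain ⟨p₃, hp₃, p₄, hp₄, hp'⟩ := eventually_prod_iff.1 hp₂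
  obtain ⟨T, hT⟩ := eventually_atTop.1 hp₃
  refine ⟨T, hp₁.mono fun ε hε t ht x hx hx' he => ?_⟩
  exact hp hε (hp' (hT t ht.le) (eventually_top.1 hp₄ x)) ⟨hx, hx', he⟩

/-- A random vector whose coordinate `k` is a.s. nonzero lies, up to small probability, in a
compact set on which that coordinate is bounded away from zero. -/
lemma exists_measure_le_of_coord_ne_zero {ι Ω : Type*} [Fintype ι] [MeasurableSpace Ω]
    (P : Measure Ω) [IsFiniteMeasure P] {X : Ω → ι → ℝ} (hX : Measurable X) (k : ι)
    (h0 : P {ω | X ω k = 0} = 0) {η : ENNReal} (hη : 0 < η) :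
    ∃ m : ℕ, P {ω | ¬(‖X ω‖ ≤ m ∧ ((m : ℝ) + 1)⁻¹ ≤ |X ω k|)} ≤ η := by
  set E : ℕ → Set Ω := fun m => {ω | ¬(‖X ω‖ ≤ m ∧ ((m : ℝ) + 1)⁻¹ ≤ |X ω k|)} with hE
  have hXk : Measurable fun ω => |X ω k| := ((measurable_pi_apply k).comp hX).abs
  have hmeas : ∀ m, MeasurableSet (E m) := fun m =>
    ((measurableSet_le hX.norm measurable_const).inter
      (measurableSet_le measurable_const hXk)).compl
  have hanti : Antitone E := by
    intro a b hab ω hω hb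
    have hab' : (a : ℝ) ≤ b := Nat.cast_le.2 hab
    refine hω ⟨hb.1.trans hab', le_trans ?_ hb.2⟩
    exact inv_anti₀ (by positivity) (by linarith)
  have hsub : (⋂ m, E m) ⊆ {ω | X ω k = 0} := by
    intro ω hω
    by_contra hne
    have hpos : 0 < |X ω k| := abs_pos.2 hne
    obtain ⟨m, hm⟩ := exists_nat_ge (max ‖X ω‖ |X ω k|⁻¹)
    refine Set.mem_iInter.1 hω m ⟨(le_max_left _ _).trans hm, ?_⟩
    exact inv_le_of_inv_le₀ hpos (by linarith [(le_max_right ‖X ω‖ |X ω k|⁻¹).trans hm])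
  have hlim := tendsto_measure_iInter_atTop (μ := P) (fun m => (hmeas m).nullMeasurableSet)
    hanti ⟨0, measure_ne_top _ _⟩
  rw [measure_mono_null hsub h0] at hlim
  exact ((ENNReal.tendsto_nhds_zero.1 hlim) η hη).exists

/- Coordinates are indexed by `Fin d`: the paper's `ξ^{(k)}` is `ξ ⟨k-1,_⟩`.  Limits as
`ε ↓ 0` are taken along `𝓝[>] 0`. -/
theorem stmt9 (d : ℕ) (hd : 1 ≤ d) (l α : ℝ) (hl : 0 < l) (hα : α ∈ Set.Ioo (0 : ℝ) 1)
    {Ω : Type*} [MeasurableSpace Ω] (P : Measure Ω) [IsProbabilityMeasure P]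
    (χ : ℝ → Ω → Fin d → ℝ) (χ₀ : Ω → Fin d → ℝ)
    (hχmeas : ∀ ε : ℝ, Measurable (χ ε)) (hχ₀meas : Measurable χ₀)
    (hχconv : ∀ δ > (0 : ℝ),
      Filter.Tendsto (fun ε : ℝ => P {ω | δ < dist (χ ε ω) (χ₀ ω)}) (𝓝[>] (0 : ℝ)) (𝓝 0))
    (hχd : P {ω | χ₀ ω ⟨d - 1, by omega⟩ = 0} = 0)
    (τ : ℝ → Ω → ℝ) (hτmeas : ∀ ε : ℝ, Measurable (τ ε)) (hτpos : ∀ ε ω, 0 < τ ε ω)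
    (hτinf : ∀ T : ℝ, Filter.Tendsto (fun ε : ℝ => P {ω | τ ε ω ≤ T}) (𝓝[>] (0 : ℝ)) (𝓝 0))
    (B : ℝ → Set Ω) (hBmeas : ∀ ε : ℝ, MeasurableSet (B ε))
    (hB1 : Filter.Tendsto (fun ε : ℝ => P (B ε)) (𝓝[>] (0 : ℝ)) (𝓝 1))
    (hBeq : ∀ ε ∈ Set.Ioo (0 : ℝ) 1, ∀ ω ∈ B ε,
      ε ^ α = ε * Real.exp (l * τ ε ω) *
        |∑ j : Fin d, τ ε ω ^ (j : ℕ) / Nat.factorial (j : ℕ) * χ ε ω j|) :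
    ∀ δ > (0 : ℝ),
      Filter.Tendsto
        (fun ε : ℝ => P {ω | δ <
          |Real.log ε⁻¹ *
            ((l * τ ε ω - (1 - α) * Real.log ε⁻¹ +
                ((d : ℝ) - 1) * Real.log (Real.log ε⁻¹) +
                Gfun d α l (χ ε ω ⟨d - 1, by omega⟩)) -
              ((d : ℝ) - 1) ^ 2 / (1 - α) * (Real.log (Real.log ε⁻¹) / Real.log ε⁻¹) -
              ((d : ℝ) - 1) *
                etafun d α l (if h : 2 ≤ d then χ ε ω ⟨d - 2, by omega⟩ else 0)
                  (χ ε ω ⟨d - 1, by omega⟩) /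
                ((1 - α) * Real.log ε⁻¹))|})
        (𝓝[>] (0 : ℝ)) (𝓝 0) := by
  intro δ hδ
  obtain ⟨n, rfl⟩ : ∃ n, d = n + 1 := ⟨d - 1, by omega⟩
  set k : Fin (n + 1) := Fin.last n
  rw [ENNReal.tendsto_nhds_zero]
  intro η hη
  have hη2 : 0 < η / 2 := ENNReal.half_pos hη.ne'
  obtain ⟨m, hm⟩ := exists_measure_le_of_coord_ne_zero P hχ₀meas k hχd hη2
  set M : ℝ := 2 * ((m : ℝ) + 1) with hMdef
  have hM : 0 < M := by positivity
  obtain ⟨T, hT⟩ := exists_forall_abs_exitRemainder_le n hl hα.2 hM hδ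
  have hBc : Tendsto (fun ε => P (B ε)ᶜ) (𝓝[>] (0 : ℝ)) (𝓝 0) := by
    have h := ENNReal.Tendsto.sub (tendsto_const_nhds (x := (1 : ENNReal))) hB1
      (Or.inl ENNReal.one_ne_top)
    rw [tsub_self] at h
    exact h.congr fun ε => (prob_compl_eq_one_sub (hBmeas ε)).symm
  have hsum := ((hχconv M⁻¹ (inv_pos.2 hM)).add (hτinf T)).add hBc
  rw [add_zero, add_zero] at hsum
  have hε1 : ∀ᶠ ε in 𝓝[>] (0 : ℝ), ε ∈ Set.Ioo (0 : ℝ) 1 := Ioo_mem_nhdsGT one_pos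
  filter_upwards [hT, hε1, ENNReal.tendsto_nhds_zero.1 hsum _ hη2] with ε hTε hε hsumε
  refine (measure_mono (t := {ω | ¬(‖χ₀ ω‖ ≤ m ∧ ((m : ℝ) + 1)⁻¹ ≤ |χ₀ ω k|)} ∪
    (({ω | M⁻¹ < dist (χ ε ω) (χ₀ ω)} ∪ {ω | τ ε ω ≤ T}) ∪ (B ε)ᶜ)) ?_).trans ?_
  · intro ω hω
    by_contra hnot
    simp only [Set.mem_union, Set.mem_ofPred_eq, Set.mem_compl_iff, not_or, not_not, not_lt,
      not_le] at hnot
    obtain ⟨⟨hnorm, hlow⟩, ⟨hdist, hτT⟩, hB⟩ := hnot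
    have hMinv : M⁻¹ ≤ 1 := inv_le_one_of_one_le₀
      (by rw [hMdef]; linarith [m.cast_nonneg (α := ℝ)])
    have hcoord : ∀ j, |χ ε ω j - χ₀ ω j| ≤ M⁻¹ := fun j =>
      (dist_le_pi_dist (χ ε ω) (χ₀ ω) j).trans hdist
    have hhalf : ((m : ℝ) + 1)⁻¹ = 2 * M⁻¹ := by rw [hMdef]; field_simp
    refine absurd (hTε (τ ε ω) hτT (χ ε ω) (fun j => ?_) ?_ (hBeq ε hε ω hB)) (not_le.2 hω)
    · have h1 := (norm_le_pi_norm (χ₀ ω) j).trans hnorm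
      rw [Real.norm_eq_abs] at h1
      have h2 := abs_sub_abs_le_abs_sub (χ ε ω j) (χ₀ ω j)
      linarith [hcoord j]
    · have h2 := abs_sub_abs_le_abs_sub (χ₀ ω k) (χ ε ω k)
      rw [abs_sub_comm] at h2
      have h3 := hcoord k
      change M⁻¹ ≤ |χ ε ω k|
      linarith
  · calc _ ≤ η / 2 + η / 2 := (measure_union_le _ _).trans (add_le_add hm
          (((measure_union_le _ _).trans (add_le_add (measure_union_le _ _) le_rfl)).trans
            hsumε))
      _ = η := ENNReal.add_halves η
end

section
/- Let $d\ge1$, $\lambda>0$, $\alpha\in(0,1)$. Let $(\chi_\varepsilon)_{\varepsilon\in(0,1)}$ be $\mathbb{R}^d$-valued random vectors converging in probability, as $\varepsilon\downarrow0$, to a random vector $\chi$ with $\mathrm P(\chi^{(d)}=0)=0$; let $(\tilde\tau_\varepsilon)$ be positive random variables with $\tilde\tau_\varepsilon\to\infty$ in probability; let $(B_\varepsilon)$ be measurable events with $\mathrm P(B_\varepsilon)\to1$; and for $1\le i\le d$ let $Y_\varepsilon^{(i)}$ be random variables such that on $B_\varepsilon$ one has $\chi_\varepsilon^{(d)}\neq0$,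 $Y_\varepsilon^{(i)}=\varepsilon\,e^{\lambda\tilde\tau_\varepsilon}\sum_{j=0}^{d-i}\frac{\tilde\tau_\varepsilon^{\,j}}{j!}\,\chi_\varepsilon^{(i+j)}$ for every $i$, and $|Y_\varepsilon^{(1)}|=\varepsilon^{\alpha}$. Then for each $1\le i\le d$ the family of random variables $\tilde\tau_\varepsilon^{\,2}\Big(\frac{(d-i)!\,\tilde\tau_\varepsilon^{\,i-1}}{(d-1)!\,\varepsilon^{\alpha}\,\operatorname{sign}(\chi_\varepsilon^{(d)})}\,Y_\varepsilon^{(i)}-1+\frac{i-1}{\tilde\tau_\varepsilon}\,\frac{\chi_\varepsilon^{(d-1)}}{\chi_\varepsilon^{(d)}}\Big)$ (defined to be $0$ off $B_\varepsilon$, and with the convention $\chi_\varepsilon^{(0)}=0$ when $d=1$) is bounded in probability as $\varepsilon\downarrow0$. -/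
open Filter Topology MeasureTheory

lemma abs_jordan_sum_sub_leading_le (n i : ℕ) (hi : i ≤ n) (x : ℕ → ℝ) (K t : ℝ) (hK : 0 ≤ K)
    (hx : ∀ k, |x k| ≤ K) (ht : 1 ≤ t) :
    |t * ((Nat.factorial (n - i) : ℝ) * t ^ i * ∑ k ∈ Finset.range (n + 1),
        (if i ≤ k then t ^ (k - i) / (Nat.factorial (k - i) : ℝ) * x k else 0))
      - t ^ (n + 1) * x n - ((n : ℝ) - i) * t ^ n * x (n - 1)| * t
      ≤ n * (Nat.factorial n : ℝ) * K * t ^ n := by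
  have ht0 : 0 < t := by linarith
  rcases n with _ | m
  · obtain rfl : i = 0 := by omega
    simp
  have htop : t * ((Nat.factorial (m + 1 - i) : ℝ) * t ^ i *
      (t ^ (m + 1 - i) / (Nat.factorial (m + 1 - i) : ℝ) * x (m + 1)))
      = t ^ (m + 1 + 1) * x (m + 1) := by
    have h1 : t ^ (m + 1) = t ^ i * t ^ (m + 1 - i) := by
      rw [← pow_add]; congr 1; omega
    have h2 : (Nat.factorial (m + 1 - i) : ℝ) ≠ 0 := by positivity
    rw [pow_succ t (m + 1), h1]
    field_simp
  have hsnd : t * ((Nat.factorial (m + 1 - i) : ℝ) * t ^ i *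
      (if i ≤ m then t ^ (m - i) / (Nat.factorial (m - i) : ℝ) * x m else 0))
      = (((m + 1 : ℕ) : ℝ) - i) * t ^ (m + 1) * x m := by
    split_ifs with h
    · have h1 : t ^ m = t ^ i * t ^ (m - i) := by
        rw [← pow_add]; congr 1; omega
      have h2 : (Nat.factorial (m - i) : ℝ) ≠ 0 := by positivity
      have h3 : m + 1 - i = (m - i) + 1 := by omega
      rw [pow_succ t m, h1, h3, Nat.factorial_succ]
      push_cast [Nat.cast_sub h]
      field_simp
      ring
    · obtain rfl : i = m + 1 := by omega
      simp
  rw [Finset.sum_range_succ, Finset.sum_range_succ, if_pos hi, mul_add, mul_add, mul_add, mul_add,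
    htop, hsnd, Nat.add_sub_cancel]
  rw [show ∀ a b c : ℝ, a + b + c - c - b = a from fun a b c => by ring]
  rw [← abs_of_pos ht0, ← abs_mul, abs_of_pos ht0, Finset.mul_sum, Finset.mul_sum, Finset.sum_mul]
  refine (Finset.abs_sum_le_sum_abs _ _).trans ?_
  have hterm : ∀ k ∈ Finset.range m,
      |t * ((Nat.factorial (m + 1 - i) : ℝ) * t ^ i *
        (if i ≤ k then t ^ (k - i) / (Nat.factorial (k - i) : ℝ) * x k else 0)) * t|
      ≤ (Nat.factorial (m + 1) : ℝ) * K * t ^ (m + 1) := by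
    intro k hk
    have hk := Finset.mem_range.mp hk
    split_ifs with h
    · have h1 : t ^ (k + 2) = t * t ^ i * t ^ (k - i) * t := by
        rw [show k + 2 = 1 + i + (k - i) + 1 by omega]
        simp only [pow_add, pow_one]
      rw [show t * ((Nat.factorial (m + 1 - i) : ℝ) * t ^ i *
        (t ^ (k - i) / (Nat.factorial (k - i) : ℝ) * x k)) * t
        = ((Nat.factorial (m + 1 - i) : ℝ) / (Nat.factorial (k - i) : ℝ)) * x k * t ^ (k + 2) by
          rw [h1]; ring]
      rw [abs_mul, abs_mul, abs_of_pos (pow_pos ht0 _), abs_of_nonneg (by positivity)]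
      have h2 : (Nat.factorial (m + 1 - i) : ℝ) / (Nat.factorial (k - i) : ℝ)
          ≤ (Nat.factorial (m + 1) : ℝ) := by
        refine (div_le_self (by positivity) ?_).trans ?_
        · exact_mod_cast Nat.factorial_pos _
        · exact_mod_cast Nat.factorial_le (by omega)
      have h3 : t ^ (k + 2) ≤ t ^ (m + 1) := pow_le_pow_right₀ ht (by omega)
      have h4 := hx k
      gcongr
    · simp only [mul_zero, zero_mul, abs_zero]
      positivity
  refine (Finset.sum_le_sum hterm).trans ?_
  rw [Finset.sum_const, Finset.card_range, nsmul_eq_mul]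
  push_cast
  have : 0 ≤ (Nat.factorial (m + 1) : ℝ) * K * t ^ (m + 1) := by positivity
  nlinarith

lemma half_le_of_abs_expansion_le (n r t C R H : ℝ) (hn : 0 ≤ n)
    (hr : |r| ≤ R) (ht : 1 ≤ t) (htC : 2 * (n * R + C) ≤ t)
    (hH : |t * H - t - n * r| * t ≤ C) : 1 / 2 ≤ H := by
  have h1 : |t * H - t - n * r| ≤ C :=
    (le_mul_of_one_le_right (abs_nonneg _) ht).trans hH
  have h2 : |n * r| ≤ n * R := by
    rw [abs_mul, abs_of_nonneg hn]; gcongr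
  have h3 := abs_le.mp h1
  have h4 := abs_le.mp h2
  by_contra! h
  nlinarith

lemma abs_ratio_expansion_le (n i r t C R H₀ H : ℝ) (hi : 0 ≤ i) (hin : i ≤ n)
    (hr : |r| ≤ R) (ht : 1 ≤ t) (htC : 2 * (n * R + C) ≤ t)
    (hH₀ : |t * H₀ - t - n * r| * t ≤ C) (hH : |t * H - t - (n - i) * r| * t ≤ C) :
    |t ^ 2 * (H / H₀ - 1 + i / t * r)| ≤ 2 * (2 * C + n * R * (n * R + C)) := by
  have hn : 0 ≤ n := hi.trans hin
  have hhalf := half_le_of_abs_expansion_le n r t C R H₀ hn hr ht htC hH₀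
  have ht0 : 0 < t := by linarith
  have hpos : 0 < H₀ := by linarith
  have hR : 0 ≤ R := (abs_nonneg r).trans hr
  set e₀ := t * H₀ - t - n * r with he₀
  set e := t * H - t - (n - i) * r with he
  have key : t ^ 2 * (H / H₀ - 1 + i / t * r) * H₀ = e * t - e₀ * t + i * r * (n * r + e₀) := by
    rw [he, he₀]; field_simp; ring
  have h1 : |e₀| ≤ C := (le_mul_of_one_le_right (abs_nonneg _) ht).trans hH₀
  have hC : 0 ≤ C := (abs_nonneg _).trans h1
  have h2 : |e * t - e₀ * t + i * r * (n * r + e₀)| ≤ 2 * C + n * R * (n * R + C) := by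
    have a1 : |e * t| ≤ C := by rwa [abs_mul, abs_of_pos ht0]
    have a2 : |e₀ * t| ≤ C := by rwa [abs_mul, abs_of_pos ht0]
    have a3 : |i * r * (n * r + e₀)| ≤ n * R * (n * R + C) := by
      have b : |n * r + e₀| ≤ n * R + C := by
        refine (abs_add_le _ _).trans ?_
        rw [abs_mul, abs_of_nonneg hn]; gcongr
      rw [abs_mul, abs_mul, abs_of_nonneg hi]
      gcongr
    have a4 := abs_add_le (e * t - e₀ * t) (i * r * (n * r + e₀))
    have a5 := abs_sub (e * t) (e₀ * t)
    linarith
  rw [← key, abs_mul, abs_of_pos hpos] at h2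
  have := abs_nonneg (t ^ 2 * (H / H₀ - 1 + i / t * r))
  nlinarith

lemma abs_mul_sign_eq_of_mul_pos {a c : ℝ} (h : 0 < a * c) : |a| * Real.sign c = a := by
  rcases lt_trichotomy c 0 with hc | hc | hc
  · have ha : a < 0 := by by_contra! ha; nlinarith
    rw [Real.sign_of_neg hc, abs_of_neg ha]; ring
  · simp [hc] at h
  · have ha : 0 < a := by by_contra! ha; nlinarith
    rw [Real.sign_of_pos hc, abs_of_pos ha]; ring

lemma exists_bound_normalized_jordan_sum (n i : ℕ) (hi : i ≤ n) (K κ : ℝ) (hK : 0 ≤ K)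
    (hκ : 0 < κ) :
    ∃ M > (0 : ℝ), ∃ T : ℝ, ∀ (x : ℕ → ℝ) (t A : ℝ) (S : ℕ → ℝ), T < t → 0 < A →
      (∀ k, |x k| ≤ K) → κ ≤ |x n| →
      (∀ k, S k = ∑ j ∈ Finset.range (n + 1),
        (if k ≤ j then t ^ (j - k) / (Nat.factorial (j - k) : ℝ) * x j else 0)) →
      |t ^ 2 * (((Nat.factorial (n - i) : ℝ) * t ^ i) /
          ((Nat.factorial n : ℝ) * |A * S 0| * Real.sign (x n)) * (A * S i)
          - 1 + (i : ℝ) / t * (x (n - 1) / x n))| ≤ M := by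
  set R := K / κ with hR
  set C := n * (Nat.factorial n : ℝ) * K / κ with hC
  have hR0 : 0 ≤ R := by positivity
  have hC0 : 0 ≤ C := by positivity
  refine ⟨2 * (2 * C + n * R * (n * R + C)) + 1, by positivity, max 1 (2 * (n * R + C)), ?_⟩
  intro x t A S hTt hA hx hxn hS
  have ht : 1 ≤ t := (le_max_left _ _).trans hTt.le
  have htC : 2 * (n * R + C) ≤ t := (le_max_right _ _).trans hTt.le
  have ht0 : 0 < t := by linarith
  have hc : 0 < |x n| := hκ.trans_le hxn
  have hc0 : x n ≠ 0 := abs_pos.mp hc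
  have hr : |x (n - 1) / x n| ≤ R := by
    rw [abs_div, hR]
    have := hx (n - 1)
    gcongr
  have hH : ∀ k ≤ n, |t * ((Nat.factorial (n - k) : ℝ) * t ^ k * S k / (t ^ n * x n)) - t
      - ((n : ℝ) - k) * (x (n - 1) / x n)| * t ≤ C := by
    intro k hk
    have h := abs_jordan_sum_sub_leading_le n k hk x K t hK hx ht
    rw [← hS k] at h
    rw [show t * ((Nat.factorial (n - k) : ℝ) * t ^ k * S k / (t ^ n * x n)) - t
      - ((n : ℝ) - k) * (x (n - 1) / x n)
      = (t * ((Nat.factorial (n - k) : ℝ) * t ^ k * S k) - t ^ (n + 1) * x n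
        - ((n : ℝ) - k) * t ^ n * x (n - 1)) / (t ^ n * x n) by
        field_simp; ring]
    rw [abs_div, div_mul_eq_mul_div, abs_mul (t ^ n), abs_of_pos (pow_pos ht0 n),
      div_le_iff₀ (by positivity)]
    refine h.trans ?_
    calc n * (Nat.factorial n : ℝ) * K * t ^ n = C * (t ^ n * κ) := by
          rw [hC]; field_simp
      _ ≤ C * (t ^ n * |x n|) := by gcongr
  have hH0 := hH 0 (Nat.zero_le n)
  simp only [Nat.cast_zero, sub_zero, Nat.sub_zero, pow_zero, mul_one] at hH0
  have hhalf := half_le_of_abs_expansion_le n _ t C R _ (Nat.cast_nonneg n) hr ht htC hH0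
  have hfin := abs_ratio_expansion_le n i _ t C R _ _ (Nat.cast_nonneg i) (Nat.cast_le.mpr hi)
    hr ht htC hH0 (hH i hi)
  have hSne : S 0 ≠ 0 := by
    intro h0; rw [h0] at hhalf; norm_num at hhalf
  have hsign : |A * S 0| * Real.sign (x n) = A * S 0 := by
    apply abs_mul_sign_eq_of_mul_pos
    have e : A * S 0 * x n = (Nat.factorial n * S 0 / (t ^ n * x n)) *
        (A * t ^ n * x n ^ 2 / Nat.factorial n) := by
      have : (Nat.factorial n : ℝ) ≠ 0 := by positivity
      field_simp
    rw [e]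
    have : 0 < (Nat.factorial n * S 0 / (t ^ n * x n)) := by linarith
    positivity
  rw [mul_assoc (Nat.factorial n : ℝ), hsign]
  have e : ((Nat.factorial (n - i) : ℝ) * t ^ i) / ((Nat.factorial n : ℝ) * (A * S 0)) * (A * S i)
      = (Nat.factorial (n - i) : ℝ) * t ^ i * S i / (t ^ n * x n) /
        (Nat.factorial n * S 0 / (t ^ n * x n)) := by
    have : (Nat.factorial n : ℝ) ≠ 0 := by positivity
    field_simp
  rw [e]
  linarith

lemma exists_measure_large_or_small_le {Ω : Type*} [MeasurableSpace Ω] (P : Measure Ω)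
    [IsProbabilityMeasure P] (f g : Ω → ℝ) (hf : Measurable f) (hg : Measurable g)
    (hg0 : P {ω | g ω = 0} = 0) (η : ENNReal) (hη : 0 < η) :
    ∃ m : ℕ, P {ω | (m : ℝ) + 1 < f ω ∨ |g ω| < 1 / ((m : ℝ) + 1)} ≤ η := by
  set s : ℕ → Set Ω := fun m => {ω | (m : ℝ) + 1 < f ω ∨ |g ω| < 1 / ((m : ℝ) + 1)} with hs
  have hmeas : ∀ m, NullMeasurableSet (s m) P := fun m =>
    ((measurableSet_lt measurable_const hf).union
      (measurableSet_lt hg.abs measurable_const)).nullMeasurableSet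
  have hanti : Antitone s := by
    intro a b hab ω hω
    have hab' : (a : ℝ) ≤ b := Nat.cast_le.mpr hab
    rcases hω with h | h
    · exact Or.inl (by linarith)
    · exact Or.inr (h.trans_le (one_div_le_one_div_of_le (by positivity) (by linarith)))
  have hlim := tendsto_measure_iInter_atTop hmeas hanti ⟨0, measure_ne_top P _⟩
  have hzero : P (⋂ m, s m) = 0 := by
    refine measure_mono_null ?_ hg0
    intro ω hω
    by_contra hne
    have hpos : 0 < |g ω| := abs_pos.mpr hne
    obtain ⟨a, ha⟩ := exists_nat_gt (max (f ω) (1 / |g ω|))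
    have ha1 := (le_max_left _ _).trans_lt ha
    have ha2 := (le_max_right _ _).trans_lt ha
    rcases Set.mem_iInter.mp hω a with h | h
    · linarith
    · have h1 : 1 / ((a : ℝ) + 1) ≤ |g ω| := by
        rw [div_le_iff₀ (by positivity)]
        rw [div_lt_iff₀ hpos] at ha2
        nlinarith
      linarith
  rw [hzero] at hlim
  obtain ⟨m, hm⟩ := (hlim.eventually_le_const hη).exists
  exact ⟨m, hm⟩

/- Coordinates are indexed by `Fin d`: the paper's `ξ^{(k)}` is `ξ ⟨k-1,_⟩`, and the
paper's index `i ∈ {1,…,d}` corresponds to `i : Fin d` with value `i-1`; thus the paper's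
`(d-i)!`, `τ^{i-1}`, `i-1` become `(d-1-i)!`, `τ^i`, `i` below.  `Set.indicator (B ε)`
implements "defined to be 0 off `B_ε`", and the `dite` implements the convention
`χ^{(0)} = 0` when `d = 1`.  Limits as `ε ↓ 0` are along `𝓝[>] 0`. -/
theorem stmt10 (d : ℕ) (hd : 1 ≤ d) (l α : ℝ) (hl : 0 < l) (hα : α ∈ Set.Ioo (0 : ℝ) 1)
    {Ω : Type*} [MeasurableSpace Ω] (P : Measure Ω) [IsProbabilityMeasure P]
    (χ : ℝ → Ω → Fin d → ℝ) (χ₀ : Ω → Fin d → ℝ)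
    (hχmeas : ∀ ε : ℝ, Measurable (χ ε)) (hχ₀meas : Measurable χ₀)
    (hχconv : ∀ δ > (0 : ℝ),
      Filter.Tendsto (fun ε : ℝ => P {ω | δ < dist (χ ε ω) (χ₀ ω)}) (𝓝[>] (0 : ℝ)) (𝓝 0))
    (hχd : P {ω | χ₀ ω ⟨d - 1, by omega⟩ = 0} = 0)
    (τ : ℝ → Ω → ℝ) (hτmeas : ∀ ε : ℝ, Measurable (τ ε)) (hτpos : ∀ ε ω, 0 < τ ε ω)
    (hτinf : ∀ T : ℝ, Filter.Tendsto (fun ε : ℝ => P {ω | τ ε ω ≤ T}) (𝓝[>] (0 : ℝ)) (𝓝 0))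
    (B : ℝ → Set Ω) (hBmeas : ∀ ε : ℝ, MeasurableSet (B ε))
    (hB1 : Filter.Tendsto (fun ε : ℝ => P (B ε)) (𝓝[>] (0 : ℝ)) (𝓝 1))
    (Y : ℝ → Fin d → Ω → ℝ) (hYmeas : ∀ (ε : ℝ) (i : Fin d), Measurable (Y ε i))
    (hBprop : ∀ ε ∈ Set.Ioo (0 : ℝ) 1, ∀ ω ∈ B ε,
      χ ε ω ⟨d - 1, by omega⟩ ≠ 0
      ∧ (∀ i : Fin d, Y ε i ω = ε * Real.exp (l * τ ε ω) *
          ∑ j : Fin d, if (i : ℕ) ≤ (j : ℕ) then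
            τ ε ω ^ ((j : ℕ) - (i : ℕ)) / Nat.factorial ((j : ℕ) - (i : ℕ)) * χ ε ω j
          else 0)
      ∧ |Y ε ⟨0, by omega⟩ ω| = ε ^ α) :
    ∀ i : Fin d, ∀ δ > (0 : ℝ), ∃ M > (0 : ℝ), ∃ ε₀ > (0 : ℝ),
      ∀ ε : ℝ, 0 < ε → ε < ε₀ →
        P {ω | M <
          |Set.indicator (B ε)
            (fun ω => τ ε ω ^ 2 *
              ((Nat.factorial (d - 1 - (i : ℕ)) * τ ε ω ^ (i : ℕ)) /
                  (Nat.factorial (d - 1) * ε ^ α *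
                    Real.sign (χ ε ω ⟨d - 1, by omega⟩)) * Y ε i ω
                - 1
                + (i : ℕ) / τ ε ω *
                  ((if h : 2 ≤ d then χ ε ω ⟨d - 2, by omega⟩ else 0) /
                    χ ε ω ⟨d - 1, by omega⟩)))
            ω|} ≤ ENNReal.ofReal δ := by
  intro i δ hδ
  obtain ⟨n, rfl⟩ : ∃ n, d = n + 1 := ⟨d - 1, by omega⟩
  have hη : (0 : ENNReal) < ENNReal.ofReal δ / 3 := by
    simp [ENNReal.div_pos_iff, hδ]
  have hlast : Measurable fun ω => χ₀ ω ⟨n + 1 - 1, by omega⟩ :=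
    (measurable_pi_apply _).comp hχ₀meas
  obtain ⟨m, hm⟩ := exists_measure_large_or_small_le P (fun ω => ‖χ₀ ω‖) _ hχ₀meas.norm hlast
    hχd _ hη
  set κ : ℝ := 1 / ((m : ℝ) + 1) / 2 with hκdef
  have hκ : 0 < κ := by positivity
  obtain ⟨M, hM, T, hMT⟩ := exists_bound_normalized_jordan_sum n i (by omega)
    ((m : ℝ) + 1 + κ) κ (by positivity) hκ
  have hev := ((hχconv κ hκ).eventually_le_const hη).and ((hτinf T).eventually_le_const hη)
  obtain ⟨ε₁, hε₁, hev⟩ := mem_nhdsGT_iff_exists_Ioo_subset.mp hev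
  refine ⟨M, hM, min ε₁ 1, lt_min hε₁ one_pos, fun ε hε hεlt => ?_⟩
  obtain ⟨hdist, htau⟩ := hev ⟨hε, hεlt.trans_le (min_le_left _ _)⟩
  have hε1 : ε ∈ Set.Ioo (0 : ℝ) 1 := ⟨hε, hεlt.trans_le (min_le_right _ _)⟩
  refine (measure_mono (t := {ω | (m : ℝ) + 1 < ‖χ₀ ω‖ ∨
      |χ₀ ω ⟨n + 1 - 1, by omega⟩| < 1 / ((m : ℝ) + 1)} ∪
      {ω | κ < dist (χ ε ω) (χ₀ ω)} ∪ {ω | τ ε ω ≤ T}) ?_).trans ?_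
  · intro ω hω
    by_contra hbad
    simp only [Set.mem_union, Set.mem_ofPred_eq, not_or, not_lt, not_le] at hbad
    obtain ⟨⟨⟨hnorm, hsmall⟩, hd⟩, hT⟩ := hbad
    by_cases hωB : ω ∈ B ε
    swap
    · simp only [Set.mem_ofPred_eq, Set.indicator_of_notMem hωB, abs_zero] at hω
      exact hω.not_gt hM
    rw [Set.mem_ofPred_eq, Set.indicator_of_mem hωB] at hω
    refine hω.not_ge ?_
    obtain ⟨-, hY, hY0⟩ := hBprop ε hε1 ω hωB
    have hcoord : ∀ k, |χ ε ω k - χ₀ ω k| ≤ κ := fun k => (dist_le_pi_dist _ _ k).trans hd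
    set x : ℕ → ℝ := fun k => if h : k < n + 1 then χ ε ω ⟨k, h⟩ else 0 with hxdef
    have hxn : x n = χ ε ω ⟨n + 1 - 1, by omega⟩ := by simp [hxdef]
    have hxb : ∀ k, |x k| ≤ (m : ℝ) + 1 + κ := by
      intro k
      by_cases h : k < n + 1
      · simp only [hxdef, h, dite_true]
        have h1 := hcoord ⟨k, h⟩
        have h2 : |χ₀ ω ⟨k, h⟩| ≤ (m : ℝ) + 1 := (norm_le_pi_norm (χ₀ ω) ⟨k, h⟩).trans hnorm
        rw [abs_le] at h1 h2 ⊢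
        constructor <;> linarith
      · simp only [hxdef, h, dite_false, abs_zero]
        positivity
    have hxlow : κ ≤ |x n| := by
      rw [hxn]
      have h1 := hcoord ⟨n + 1 - 1, by omega⟩
      have h2 := abs_sub_abs_le_abs_sub (χ₀ ω ⟨n + 1 - 1, by omega⟩)
        (χ ε ω ⟨n + 1 - 1, by omega⟩)
      rw [abs_sub_comm] at h2
      have h3 : 1 / ((m : ℝ) + 1) = 2 * κ := by rw [hκdef]; ring
      linarith
    have hYx : ∀ k : Fin (n + 1), Y ε k ω = ε * Real.exp (l * τ ε ω) *
        ∑ j ∈ Finset.range (n + 1), if (k : ℕ) ≤ j then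
          τ ε ω ^ (j - (k : ℕ)) / (Nat.factorial (j - (k : ℕ)) : ℝ) * x j else 0 := by
      intro k
      rw [hY k, Finset.sum_range]
      simp only [hxdef, Fin.is_lt, dite_true, Fin.eta]
    have hfin := hMT x (τ ε ω) (ε * Real.exp (l * τ ε ω)) _ hT (by positivity) hxb hxlow
      (fun _ => rfl)
    have hY0x := hYx ⟨0, by omega⟩
    simp only at hY0x
    rw [← hYx i, ← hY0x, hY0, hxn] at hfin
    have hsub : (i : ℝ) / τ ε ω * ((if h : 2 ≤ n + 1 then χ ε ω ⟨n + 1 - 2, by omega⟩ else 0) /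
        χ ε ω ⟨n + 1 - 1, by omega⟩)
        = (i : ℝ) / τ ε ω * (x (n - 1) / χ ε ω ⟨n + 1 - 1, by omega⟩) := by
      by_cases h : 2 ≤ n + 1
      · have h1 : n - 1 < n + 1 := by omega
        simp only [h, h1, hxdef, dite_true]
        rfl
      · have h0 : (i : ℕ) = 0 := by omega
        simp [h0]
    simp only [hsub]
    exact hfin
  · refine (measure_union_le _ _).trans ?_
    refine (add_le_add (measure_union_le _ _) le_rfl).trans ?_
    refine (add_le_add (add_le_add hm hdist) htau).trans ?_
    rw [ENNReal.add_thirds]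
end

section
/- Let $d\ge1$, $\lambda>0$, $\alpha\in(0,1)$, $R>0$. Let $(\chi_\varepsilon)_{\varepsilon\in(0,1)}$ be $\mathbb{R}^d$-valued random vectors converging in probability, as $\varepsilon\downarrow0$, to a random vector $\chi$ with $\mathrm P(\chi^{(d)}=0)=0$. Let $(\tilde\tau_\varepsilon)$ and $(\bar\tau_\varepsilon)$ be positive random variables such that, with $G_\varepsilon=\log\big(|\chi_\varepsilon^{(d)}|\,(1-\alpha)^{d-1}/((d-1)!\,\lambda^{d-1})\big)$ (set to $0$ when $\chi_\varepsilon^{(d)}=0$), one has $\lambda\tilde\tau_\varepsilon-(1-\alpha)\log\varepsilon^{-1}+(d-1)\log\log\varepsilon^{-1}+G_\varepsilon\to0$ in probability. Let $(r_\varepsilon)$ be random variables with $(\tilde\tau_\varepsilon^{\,2}\,r_\varepsilon)$ bounded in probability, and let $(B_\varepsilon)$ be events with $\mathrm P(B_\varepsilon)\to1$ on which $\chi_\varepsilon^{(d)}\neq0$ and $R=\varepsilon^{\alpha}\,e^{\lambda\bar\tau_\varepsilon}\,\Big(\frac{\tilde\tau_\varepsilon+\bar\tau_\varepsilon}{\tilde\tau_\varepsilon}\Big)^{d-1}\,\Big|1-\frac{d-1}{\tilde\tau_\varepsilon}\,\frac{\chi_\varepsilon^{(d-1)}}{\chi_\varepsilon^{(d)}}\,\frac{\bar\tau_\varepsilon}{\tilde\tau_\varepsilon+\bar\tau_\varepsilon}+r_\varepsilon\Big|$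 (convention $\chi_\varepsilon^{(0)}=0$ when $d=1$). Then, as $\varepsilon\downarrow0$: (i) $\lambda\bar\tau_\varepsilon-\alpha\log\varepsilon^{-1}-(d-1)\log(1-\alpha)-\log R\to0$ in probability; and (ii) $\lambda(\tilde\tau_\varepsilon+\bar\tau_\varepsilon)-\log\varepsilon^{-1}+(d-1)\log\log\varepsilon^{-1}+\log\frac{|\chi_\varepsilon^{(d)}|}{R\,(d-1)!\,\lambda^{d-1}}\to0$ in probability. -/
open Filter Topology MeasureTheory

/-- The filter on `ℝ × Ω` of sets whose sections at `ε` have probability tending to one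
as `ε ↓ 0`; convergence in probability is convergence along this filter. -/
def probFilter {Ω : Type*} [MeasurableSpace Ω] (P : Measure Ω) : Filter (ℝ × Ω) where
  sets := {S | Tendsto (fun ε : ℝ => P {ω | (ε, ω) ∉ S}) (𝓝[>] (0 : ℝ)) (𝓝 0)}
  univ_sets := by simp
  sets_of_superset {S T} hS hST :=
    tendsto_of_tendsto_of_tendsto_of_le_of_le tendsto_const_nhds hS (fun _ => zero_le)
      fun _ => measure_mono fun _ h h' => h (hST h')
  inter_sets {S T} hS hT := by
    have h := Tendsto.add (Set.mem_ofPred_eq.mp hS) (Set.mem_ofPred_eq.mp hT)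
    rw [add_zero] at h
    refine tendsto_of_tendsto_of_tendsto_of_le_of_le tendsto_const_nhds h (fun _ => zero_le)
      fun ε => ?_
    refine (measure_mono ?_).trans (measure_union_le _ _)
    intro ω hω
    by_contra hc
    simp only [Set.mem_union, Set.mem_ofPred_eq, not_or, not_not] at hc
    exact hω hc

section probFilter

variable {Ω : Type*} [MeasurableSpace Ω] {P : Measure Ω}

lemma eventually_probFilter {p : ℝ × Ω → Prop} :
    (∀ᶠ z in probFilter P, p z) ↔
      Tendsto (fun ε : ℝ => P {ω | ¬ p (ε, ω)}) (𝓝[>] (0 : ℝ)) (𝓝 0) := Iff.rfl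

lemma tendsto_fst_probFilter : Tendsto Prod.fst (probFilter P) (𝓝[>] (0 : ℝ)) := by
  intro S hS
  refine eventually_probFilter.mpr (tendsto_const_nhds.congr' ?_)
  filter_upwards [hS] with ε hε
  simp [hε]

lemma tendsto_zero_probFilter {f : ℝ × Ω → ℝ} :
    Tendsto f (probFilter P) (𝓝 0) ↔
      ∀ δ > (0 : ℝ), Tendsto (fun ε : ℝ => P {ω | δ < |f (ε, ω)|}) (𝓝[>] (0 : ℝ)) (𝓝 0) := by
  rw [(nhds_basis_zero_abs_lt ℝ).tendsto_right_iff]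
  constructor
  · intro h δ hδ
    refine eventually_probFilter.mp ((h δ hδ).mono fun z (hz : |f z| < δ) => hz.le) |>.congr ?_
    simp
  · intro h δ hδ
    have h2 : ∀ᶠ z in probFilter P, |f z| ≤ δ / 2 := by
      refine eventually_probFilter.mpr ((h (δ / 2) (half_pos hδ)).congr ?_)
      simp
    exact h2.mono fun z hz => lt_of_le_of_lt hz (half_lt_self hδ)

lemma le_probFilter_of_local {F : Filter (ℝ × Ω)}
    (h : ∀ δ > (0 : ℝ), ∃ A : Set (ℝ × Ω),
      (∀ᶠ ε in 𝓝[>] (0 : ℝ), P {ω | (ε, ω) ∉ A} ≤ ENNReal.ofReal δ) ∧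
        probFilter P ⊓ 𝓟 A ≤ F) :
    probFilter P ≤ F := by
  intro S hS
  refine ENNReal.tendsto_nhds_zero.mpr fun δ hδ => ?_
  obtain ⟨q, -, hq, hqδ⟩ := ENNReal.lt_iff_exists_real_btwn.mp hδ
  have hq0 : 0 < q := ENNReal.ofReal_pos.mp hq
  obtain ⟨A, hA, hAF⟩ := h (q / 2) (half_pos hq0)
  have hSA := ENNReal.tendsto_nhds_zero.mp
    (eventually_probFilter.mp (mem_inf_principal.mp (hAF hS))) _
    (ENNReal.ofReal_pos.mpr (half_pos hq0))
  filter_upwards [hA, hSA] with ε h1 h2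
  calc P {ω | (ε, ω) ∉ S}
      ≤ P ({ω | (ε, ω) ∉ A} ∪ {ω | ¬ ((ε, ω) ∈ A → (ε, ω) ∈ S)}) := by
        refine measure_mono fun ω hω => ?_
        by_cases hc : (ε, ω) ∈ A
        · exact Or.inr fun h' => hω (h' hc)
        · exact Or.inl hc
    _ ≤ _ := measure_union_le _ _
    _ ≤ ENNReal.ofReal (q / 2) + ENNReal.ofReal (q / 2) := add_le_add h1 h2
    _ = ENNReal.ofReal q := by
        rw [← ENNReal.ofReal_add (half_pos hq0).le (half_pos hq0).le, add_halves]
    _ ≤ δ := hqδ.le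

lemma exists_measure_lt_le [IsFiniteMeasure P] {Z : Ω → ℝ} (hZ : Measurable Z)
    {δ : ℝ} (hδ : 0 < δ) : ∃ K > (0 : ℝ), P {ω | K < Z ω} ≤ ENNReal.ofReal δ := by
  have h : Tendsto (fun n : ℕ => P {ω | (n : ℝ) < Z ω}) atTop
      (𝓝 (P (⋂ n : ℕ, {ω | (n : ℝ) < Z ω}))) := by
    refine tendsto_measure_iInter_atTop
      (fun n => (measurableSet_lt measurable_const hZ).nullMeasurableSet) ?_
      ⟨0, measure_ne_top _ _⟩
    intro m n hmn ω hω
    have hω : (n : ℝ) < Z ω := hω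
    exact lt_of_le_of_lt (Nat.cast_le.mpr hmn) hω
  have h0 : (⋂ n : ℕ, {ω | (n : ℝ) < Z ω}) = ∅ := by
    refine Set.eq_empty_of_forall_notMem fun ω hω => ?_
    obtain ⟨n, hn⟩ := exists_nat_ge (Z ω)
    exact absurd (Set.mem_iInter.mp hω n) (not_lt.mpr hn)
  rw [h0, measure_empty] at h
  obtain ⟨n, hn, hn0⟩ := ((ENNReal.tendsto_nhds_zero.mp h _ (ENNReal.ofReal_pos.mpr hδ)).and
    (eventually_gt_atTop 0)).exists
  exact ⟨n, Nat.cast_pos.mpr hn0, hn⟩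

end probFilter

lemma Gfun_eq {d : ℕ} {α l x : ℝ} (hα : α < 1) (hl : 0 < l) (hx : x ≠ 0) :
    Gfun d α l x = Real.log |x| + ((d - 1 : ℕ) : ℝ) * Real.log (1 - α) -
      Real.log (Nat.factorial (d - 1) * l ^ (d - 1)) := by
  have h1 : (1 - α) ^ (d - 1) ≠ 0 := pow_ne_zero _ (by linarith)
  rw [Gfun, if_neg hx, Real.log_div (by positivity) (by positivity),
    Real.log_mul (by positivity) h1, Real.log_pow]

lemma tendsto_mul_zero_of_eventually_abs_le {ι : Type*} {G : Filter ι} {f g : ι → ℝ} {C : ℝ}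
    (hf : ∀ᶠ i in G, |f i| ≤ C) (hg : Tendsto g G (𝓝 0)) :
    Tendsto (fun i => f i * g i) G (𝓝 0) :=
  bdd_le_mul_tendsto_zero' C hf hg

/-- Asymptotics of the solution `b` of the exit-time equation along an arbitrary filter. -/
lemma tendsto_exit_time {ι : Type*} {G : Filter ι} {n : ℕ} {l α R : ℝ} (hl : 0 < l)
    (hα : α ∈ Set.Ioo (0 : ℝ) 1) {e g q r t b : ι → ℝ}
    (he : Tendsto e G (𝓝[>] 0)) (ht : ∀ i, 0 < t i) (hb : ∀ i, 0 < b i)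
    {C D M : ℝ} (hg : ∀ᶠ i in G, |g i| ≤ C)
    (hq : ∀ᶠ i in G, |q i| ≤ D) (hr : ∀ᶠ i in G, |t i ^ 2 * r i| ≤ M)
    (htg : Tendsto (fun i => l * t i - (1 - α) * Real.log (e i)⁻¹ +
      (n : ℝ) * Real.log (Real.log (e i)⁻¹) + g i) G (𝓝 0))
    (heq : ∀ᶠ i in G, R = e i ^ α * Real.exp (l * b i) * ((t i + b i) / t i) ^ n *
      |1 - (n : ℝ) / t i * q i * (b i / (t i + b i)) + r i|) :
    Tendsto (fun i => l * b i - α * Real.log (e i)⁻¹ - (n : ℝ) * Real.log (1 - α) -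
      Real.log R) G (𝓝 0) := by
  obtain ⟨hα0, hα1⟩ := hα
  set L : ι → ℝ := fun i => Real.log (e i)⁻¹ with hL
  have hLtop : Tendsto L G atTop :=
    Real.tendsto_log_atTop.comp (tendsto_inv_nhdsGT_zero.comp he)
  have hLpos : ∀ᶠ i in G, 0 < L i := hLtop.eventually_gt_atTop 0
  have hLinv : Tendsto (fun i => (L i)⁻¹) G (𝓝 0) := tendsto_inv_atTop_zero.comp hLtop
  have hloglog : Tendsto (fun i => Real.log (L i) / L i) G (𝓝 0) :=
    Real.isLittleO_log_id_atTop.tendsto_div_nhds_zero.comp hLtop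
  have htL : Tendsto (fun i => t i / L i) G (𝓝 ((1 - α) / l)) := by
    have h := (((htg.mul hLinv).add_const (1 - α)).sub (hloglog.const_mul (n : ℝ))).sub
      (tendsto_mul_zero_of_eventually_abs_le hg hLinv)
    have h' := h.div_const l
    simp only [mul_zero, zero_add, sub_zero] at h'
    refine h'.congr' ?_
    filter_upwards [hLpos] with i hi
    change ((l * t i - (1 - α) * L i + n * Real.log (L i) + g i) * (L i)⁻¹ + (1 - α) -
      n * (Real.log (L i) / L i) - g i * (L i)⁻¹) / l = t i / L i
    field_simp
    ring
  have hpos : 0 < (1 - α) / l := div_pos (by linarith) hl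
  have httop : Tendsto t G atTop := by
    refine (htL.pos_mul_atTop hpos hLtop).congr' ?_
    filter_upwards [hLpos] with i hi
    field_simp
  have htinv : Tendsto (fun i => (t i)⁻¹) G (𝓝 0) := tendsto_inv_atTop_zero.comp httop
  have hr0 : Tendsto r G (𝓝 0) := by
    have h2 : Tendsto (fun i => (t i)⁻¹ ^ 2) G (𝓝 0) := by simpa using htinv.pow 2
    have h := tendsto_mul_zero_of_eventually_abs_le hr h2
    refine h.congr fun i => ?_
    have := (ht i).ne'
    field_simp
  set m : ι → ℝ := fun i => 1 - (n : ℝ) / t i * q i * (b i / (t i + b i)) + r i with hm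
  have hqb : ∀ᶠ i in G, |q i * (b i / (t i + b i))| ≤ D := by
    filter_upwards [hq] with i hi
    have h1 : 0 ≤ b i / (t i + b i) := div_nonneg (hb i).le (add_pos (ht i) (hb i)).le
    have h2 : b i / (t i + b i) ≤ 1 :=
      (div_le_one (add_pos (ht i) (hb i))).mpr (by linarith [ht i])
    rw [abs_mul, abs_of_nonneg h1]
    exact (mul_le_of_le_one_right (abs_nonneg _) h2).trans hi
  have hm1 : Tendsto m G (𝓝 1) := by
    have hn : Tendsto (fun i => (n : ℝ) * (t i)⁻¹) G (𝓝 0) := by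
      simpa using htinv.const_mul (n : ℝ)
    have h := ((tendsto_mul_zero_of_eventually_abs_le hqb hn).const_sub 1).add hr0
    simp only [sub_zero, add_zero] at h
    refine h.congr fun i => ?_
    simp only [hm]
    ring
  have hlogm : Tendsto (fun i => Real.log (m i)) G (𝓝 0) := by
    simpa using hm1.log one_ne_zero
  set s : ι → ℝ := fun i => b i / t i with hs
  have hs0 : ∀ i, 0 < s i := fun i => div_pos (hb i) (ht i)
  have hlog : ∀ᶠ i in G,
      l * b i = α * L i + Real.log R - Real.log (m i) - n * Real.log (1 + s i) := by
    filter_upwards [heq, he self_mem_nhdsWithin, hm1.eventually_ne one_ne_zero] with i hi hei hmi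
    have hei : 0 < e i := hei
    have hsi : (t i + b i) / t i = 1 + s i := by
      have := (ht i).ne'
      simp only [hs]
      field_simp
    have h1 : 0 < 1 + s i := by linarith [hs0 i]
    rw [hsi] at hi
    have h2 := congrArg Real.log hi
    rw [Real.log_mul (by positivity) (abs_ne_zero.mpr hmi),
      Real.log_mul (by positivity) (by positivity), Real.log_mul (by positivity) (by positivity),
      Real.log_rpow hei, Real.log_exp, Real.log_pow, Real.log_abs] at h2
    simp only [hL, Real.log_inv]
    change Real.log R = α * Real.log (e i) + l * b i + n * Real.log (1 + s i) +
      Real.log (m i) at h2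
    linarith
  have hbase : Tendsto (fun i => (α + Real.log R * (L i)⁻¹ - Real.log (m i) * (L i)⁻¹) / l) G
      (𝓝 (α / l)) := by
    simpa using (((hLinv.const_mul (Real.log R)).const_add α).sub (hlogm.mul hLinv)).div_const l
  have hbbase : ∀ᶠ i in G, b i / L i =
      (α + Real.log R * (L i)⁻¹ - Real.log (m i) * (L i)⁻¹) / l -
        n * Real.log (1 + s i) * (L i)⁻¹ / l := by
    filter_upwards [hlog, hLpos] with i hi hLi
    field_simp
    linarith
  have hsL : ∀ᶠ i in G, s i = b i / L i / (t i / L i) := by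
    filter_upwards [hLpos] with i hLi
    have := (ht i).ne'
    simp only [hs]
    field_simp
  have hsb : ∀ᶠ i in G, s i ≤ α / l / ((1 - α) / l) + 1 := by
    filter_upwards [hbbase, hsL, hLpos,
      (hbase.div htL hpos.ne').eventually_le_const (lt_add_one _)] with i h1 h2 h3 h4
    rw [h2]
    refine le_trans ?_ h4
    refine div_le_div_of_nonneg_right ?_ (div_pos (ht i) h3).le
    rw [h1]
    have : 0 ≤ Real.log (1 + s i) := Real.log_nonneg (by linarith [hs0 i])
    have : 0 ≤ n * Real.log (1 + s i) * (L i)⁻¹ / l := by positivity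
    linarith
  have hslog : ∀ᶠ i in G, |(n : ℝ) * Real.log (1 + s i)| ≤
      n * Real.log (1 + (α / l / ((1 - α) / l) + 1)) := by
    filter_upwards [hsb] with i hi
    have : 0 ≤ Real.log (1 + s i) := Real.log_nonneg (by linarith [hs0 i])
    rw [abs_of_nonneg (by positivity)]
    have h1 : 0 < 1 + s i := by linarith [hs0 i]
    gcongr
  have hbL : Tendsto (fun i => b i / L i) G (𝓝 (α / l)) := by
    have h := hbase.sub ((tendsto_mul_zero_of_eventually_abs_le hslog hLinv).div_const l)
    simp only [zero_div, sub_zero] at h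
    exact h.congr' (hbbase.mono fun i hi => hi.symm)
  have hslim : Tendsto (fun i => 1 + s i) G (𝓝 ((1 - α)⁻¹)) := by
    have h := (hbL.div htL hpos.ne').const_add 1
    have hval : 1 + α / l / ((1 - α) / l) = (1 - α)⁻¹ := by
      have : 1 - α ≠ 0 := by linarith
      field_simp
      ring
    rw [hval] at h
    exact h.congr' (hsL.mono fun i hi => by simp only [hi, Pi.div_apply])
  have hlims := (hslim.log (inv_ne_zero (by linarith))).const_mul (n : ℝ)
  have hfin := (hlogm.neg.sub hlims).sub_const (n * Real.log (1 - α))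
  simp only [Real.log_inv, neg_zero, mul_neg, sub_neg_eq_add, zero_add, sub_self] at hfin
  refine hfin.congr' ?_
  filter_upwards [hlog] with i hi
  rw [hi]
  ring

/- Coordinates are indexed by `Fin d`: the paper's `ξ^{(k)}` is `ξ ⟨k-1,_⟩`; the `dite`
implements the convention `χ^{(0)} = 0` when `d = 1`.  Limits as `ε ↓ 0` are along
`𝓝[>] 0`. -/
theorem stmt12 (d : ℕ) (hd : 1 ≤ d) (l α R : ℝ) (hl : 0 < l)
    (hα : α ∈ Set.Ioo (0 : ℝ) 1) (hR : 0 < R)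
    {Ω : Type*} [MeasurableSpace Ω] (P : Measure Ω) [IsProbabilityMeasure P]
    (χ : ℝ → Ω → Fin d → ℝ) (χ₀ : Ω → Fin d → ℝ)
    (hχmeas : ∀ ε : ℝ, Measurable (χ ε)) (hχ₀meas : Measurable χ₀)
    (hχconv : ∀ δ > (0 : ℝ),
      Filter.Tendsto (fun ε : ℝ => P {ω | δ < dist (χ ε ω) (χ₀ ω)}) (𝓝[>] (0 : ℝ)) (𝓝 0))
    (hχd : P {ω | χ₀ ω ⟨d - 1, by omega⟩ = 0} = 0)
    (τt τb : ℝ → Ω → ℝ)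
    (hτtmeas : ∀ ε : ℝ, Measurable (τt ε)) (hτbmeas : ∀ ε : ℝ, Measurable (τb ε))
    (hτtpos : ∀ ε ω, 0 < τt ε ω) (hτbpos : ∀ ε ω, 0 < τb ε ω)
    (hτt : ∀ δ > (0 : ℝ),
      Filter.Tendsto
        (fun ε : ℝ => P {ω | δ <
          |l * τt ε ω - (1 - α) * Real.log ε⁻¹ + ((d : ℝ) - 1) * Real.log (Real.log ε⁻¹) +
            Gfun d α l (χ ε ω ⟨d - 1, by omega⟩)|})
        (𝓝[>] (0 : ℝ)) (𝓝 0))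
    (r : ℝ → Ω → ℝ) (hrmeas : ∀ ε : ℝ, Measurable (r ε))
    (hrbdd : ∀ δ > (0 : ℝ), ∃ M > (0 : ℝ), ∃ ε₀ > (0 : ℝ), ∀ ε : ℝ, 0 < ε → ε < ε₀ →
      P {ω | M < |τt ε ω ^ 2 * r ε ω|} ≤ ENNReal.ofReal δ)
    (B : ℝ → Set Ω) (hBmeas : ∀ ε : ℝ, MeasurableSet (B ε))
    (hB1 : Filter.Tendsto (fun ε : ℝ => P (B ε)) (𝓝[>] (0 : ℝ)) (𝓝 1))
    (hBeq : ∀ ε ∈ Set.Ioo (0 : ℝ) 1, ∀ ω ∈ B ε,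
      χ ε ω ⟨d - 1, by omega⟩ ≠ 0
      ∧ R = ε ^ α * Real.exp (l * τb ε ω) *
          ((τt ε ω + τb ε ω) / τt ε ω) ^ (d - 1) *
          |1 - ((d : ℝ) - 1) / τt ε ω *
              ((if h : 2 ≤ d then χ ε ω ⟨d - 2, by omega⟩ else 0) /
                χ ε ω ⟨d - 1, by omega⟩) *
              (τb ε ω / (τt ε ω + τb ε ω)) + r ε ω|) :
    (∀ δ > (0 : ℝ),
      Filter.Tendsto
        (fun ε : ℝ => P {ω | δ <
          |l * τb ε ω - α * Real.log ε⁻¹ - ((d : ℝ) - 1) * Real.log (1 - α) - Real.log R|})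
        (𝓝[>] (0 : ℝ)) (𝓝 0))
    ∧ ∀ δ > (0 : ℝ),
        Filter.Tendsto
          (fun ε : ℝ => P {ω | δ <
            |l * (τt ε ω + τb ε ω) - Real.log ε⁻¹ +
              ((d : ℝ) - 1) * Real.log (Real.log ε⁻¹) +
              Real.log (|χ ε ω ⟨d - 1, by omega⟩| /
                (R * Nat.factorial (d - 1) * l ^ (d - 1)))|})
          (𝓝[>] (0 : ℝ)) (𝓝 0) := by
  obtain ⟨hα0, hα1⟩ := id hα
  have hnd : ((d - 1 : ℕ) : ℝ) = (d : ℝ) - 1 := by push_cast [hd]; ring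
  set k : Fin d := ⟨d - 1, by omega⟩ with hk
  set y : ℝ × Ω → ℝ := fun z => if h : 2 ≤ d then χ z.1 z.2 ⟨d - 2, by omega⟩ else 0 with hy
  have hχ' : ∀ᶠ z in probFilter P, χ₀ z.2 k ≠ 0 := by
    refine eventually_probFilter.mpr ?_
    simp [hχd]
  have hdist : Tendsto (fun z : ℝ × Ω => dist (χ z.1 z.2) (χ₀ z.2)) (probFilter P) (𝓝 0) :=
    tendsto_zero_probFilter.mpr (by simpa only [abs_dist] using hχconv)
  have hBev : ∀ᶠ z in probFilter P, z.2 ∈ B z.1 := by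
    refine eventually_probFilter.mpr ?_
    have h := ENNReal.Tendsto.sub tendsto_const_nhds hB1 (Or.inl ENNReal.one_ne_top)
    rw [tsub_self] at h
    exact h.congr fun ε => (prob_compl_eq_one_sub (hBmeas ε)).symm
  have hε01 : ∀ᶠ z in probFilter P, z.1 ∈ Set.Ioo (0 : ℝ) 1 :=
    tendsto_fst_probFilter (Ioo_mem_nhdsGT one_pos)
  have hBE := (hBev.and hε01).mono fun z hz => hBeq z.1 hz.2 z.2 hz.1
  have hτ := tendsto_zero_probFilter (P := P)
    (f := fun z => l * τt z.1 z.2 - (1 - α) * Real.log z.1⁻¹ +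
      ((d : ℝ) - 1) * Real.log (Real.log z.1⁻¹) + Gfun d α l (χ z.1 z.2 k)) |>.mpr hτt
  have hmain : Tendsto (fun z : ℝ × Ω => l * τb z.1 z.2 - α * Real.log z.1⁻¹ -
      ((d : ℝ) - 1) * Real.log (1 - α) - Real.log R) (probFilter P) (𝓝 0) := by
    refine map_le_iff_le_comap.mpr (le_probFilter_of_local fun δ hδ => ?_)
    obtain ⟨M, -, ε₀, hε₀, hM⟩ := hrbdd (δ / 2) (half_pos hδ)
    have hZ : Measurable fun ω => ‖χ₀ ω‖ + |χ₀ ω k|⁻¹ := by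
      have h1 : Measurable fun ω => χ₀ ω k := (measurable_pi_apply k).comp hχ₀meas
      exact hχ₀meas.norm.add h1.abs.inv
    obtain ⟨K, hK, hKP⟩ := exists_measure_lt_le (P := P) hZ (half_pos hδ)
    refine ⟨{z | ‖χ₀ z.2‖ + |χ₀ z.2 k|⁻¹ ≤ K ∧ |τt z.1 z.2 ^ 2 * r z.1 z.2| ≤ M}, ?_, ?_⟩
    · filter_upwards [Ioo_mem_nhdsGT hε₀] with ε hε
      calc _ ≤ P ({ω | K < ‖χ₀ ω‖ + |χ₀ ω k|⁻¹} ∪ {ω | M < |τt ε ω ^ 2 * r ε ω|}) := by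
            refine measure_mono fun ω hω => ?_
            simp only [Set.mem_ofPred_eq, not_and_or, not_le] at hω
            exact hω
        _ ≤ _ := measure_union_le _ _
        _ ≤ ENNReal.ofReal (δ / 2) + ENNReal.ofReal (δ / 2) :=
            add_le_add hKP (hM ε hε.1 hε.2)
        _ = ENNReal.ofReal δ := by
            rw [← ENNReal.ofReal_add (half_pos hδ).le (half_pos hδ).le, add_halves]
    · refine map_le_iff_le_comap.mp ?_
      set A : Set (ℝ × Ω) :=
        {z | ‖χ₀ z.2‖ + |χ₀ z.2 k|⁻¹ ≤ K ∧ |τt z.1 z.2 ^ 2 * r z.1 z.2| ≤ M} with hA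
      have hle : probFilter P ⊓ 𝓟 A ≤ probFilter P := inf_le_left
      have hmem : ∀ᶠ z in probFilter P ⊓ 𝓟 A, z ∈ A := mem_inf_of_right (mem_principal_self A)
      have hcoord : ∀ᶠ z in probFilter P ⊓ 𝓟 A,
          (2 * K)⁻¹ ≤ |χ z.1 z.2 k| ∧ ∀ j, |χ z.1 z.2 j| ≤ K + (2 * K)⁻¹ := by
        filter_upwards [hmem, hχ'.filter_mono hle,
          (hdist.mono_left hle).eventually_le_const (show 0 < (2 * K)⁻¹ by positivity)]
          with z hz hz0 hzd
        have hzinv : |χ₀ z.2 k|⁻¹ ≤ K := by linarith [hz.1, norm_nonneg (χ₀ z.2)]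
        have hlow : K⁻¹ ≤ |χ₀ z.2 k| := inv_le_of_inv_le₀ (abs_pos.mpr hz0) hzinv
        have hdj : ∀ j, |χ z.1 z.2 j - χ₀ z.2 j| ≤ (2 * K)⁻¹ := fun j =>
          (dist_le_pi_dist (χ z.1 z.2) (χ₀ z.2) j).trans hzd
        refine ⟨?_, fun j => ?_⟩
        · have h1 := abs_sub_abs_le_abs_sub (χ₀ z.2 k) (χ z.1 z.2 k)
          rw [abs_sub_comm] at h1
          have h2 : K⁻¹ = (2 * K)⁻¹ + (2 * K)⁻¹ := by field_simp; norm_num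
          linarith [hdj k]
        · have h1 := abs_sub_abs_le_abs_sub (χ z.1 z.2 j) (χ₀ z.2 j)
          have h2 : |χ₀ z.2 j| ≤ ‖χ₀ z.2‖ := norm_le_pi_norm (χ₀ z.2) j
          have h3 : 0 ≤ |χ₀ z.2 k|⁻¹ := by positivity
          linarith [hdj j, hz.1]
      have hK2 : 0 < (2 * K)⁻¹ := by positivity
      have hg : ∀ᶠ z in probFilter P ⊓ 𝓟 A, |Gfun d α l (χ z.1 z.2 k)| ≤
          max |Real.log (2 * K)⁻¹| |Real.log (K + (2 * K)⁻¹)| +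
          |((d - 1 : ℕ) : ℝ) * Real.log (1 - α)| +
          |Real.log (Nat.factorial (d - 1) * l ^ (d - 1))| := by
        filter_upwards [hcoord] with z hz
        have hx : 0 < |χ z.1 z.2 k| := hK2.trans_le hz.1
        rw [Gfun_eq hα1 hl (abs_pos.mp hx)]
        refine (abs_sub _ _).trans (add_le_add_left ((abs_add_le _ _).trans
          (add_le_add_left ?_ _)) _)
        exact abs_le_max_abs_abs (Real.log_le_log hK2 hz.1) (Real.log_le_log hx (hz.2 k))
      have hq : ∀ᶠ z in probFilter P ⊓ 𝓟 A, |y z / χ z.1 z.2 k| ≤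
          (K + (2 * K)⁻¹) / (2 * K)⁻¹ := by
        filter_upwards [hcoord] with z hz
        rw [abs_div]
        have hyz : |y z| ≤ K + (2 * K)⁻¹ := by
          simp only [hy]
          split_ifs
          · exact hz.2 _
          · rw [abs_zero]; positivity
        gcongr
        exact hz.1
      have hfin := tendsto_exit_time (n := d - 1) (e := Prod.fst)
        (t := fun z : ℝ × Ω => τt z.1 z.2) (b := fun z => τb z.1 z.2)
        (r := fun z => r z.1 z.2) hl hα (tendsto_fst_probFilter.mono_left hle)
        (fun z => hτtpos _ _) (fun z => hτbpos _ _) hg hq (hmem.mono fun z hz => hz.2)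
        (by simpa only [hnd] using hτ.mono_left hle)
        (by
          simp only [hnd]
          exact (hBE.filter_mono hle).mono fun z hz => hz.2)
      simp only [hnd] at hfin
      exact hfin
  refine ⟨tendsto_zero_probFilter.mp hmain, tendsto_zero_probFilter
    (f := fun z => l * (τt z.1 z.2 + τb z.1 z.2) - Real.log z.1⁻¹ +
      ((d : ℝ) - 1) * Real.log (Real.log z.1⁻¹) +
      Real.log (|χ z.1 z.2 k| / (R * Nat.factorial (d - 1) * l ^ (d - 1)))) |>.mp ?_⟩
  have hsum := hτ.add hmain
  rw [add_zero] at hsum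
  refine hsum.congr' ?_
  filter_upwards [hBE] with z hz
  have hx : χ z.1 z.2 k ≠ 0 := hz.1
  rw [Gfun_eq hα1 hl hx, hnd, mul_assoc R, Real.log_div (by positivity) (by positivity),
    Real.log_mul hR.ne' (by positivity)]
  ring
end
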